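/- arXiv:1902.00426 — 2 statements merged into one kernel-verified Lean document; each statement's English description precedes it below -/
import Mathlib

section
/- Let F ⊆ [0,1] be a self-similar set for similitudes f_j(x) = r_j x + b_j, j ∈ 𝒜, with F not a singleton, and suppose log r_j / log r_ℓ is irrational for some j ≠ ℓ. Then every self-similar measure μ on F (with positive weights) satisfies μ̂(ξ) → 0 as |ξ| → ∞. -/
open MeasureTheory Filter Topology

lemma ren_density (a b : ℝ) (h : Irrational (a / b)) (c ε : ℝ) (hε : 0 < ε) :
    ∃ (s : ℝ) (N : ℕ), ∀ y, 0 ≤ y → y ≤ c → ∃ k l : ℕ, k ≤ N ∧ l ≤ N ∧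
      |s + y - (k * a + l * b)| ≤ ε := by
  have hd := dense_addSubgroupClosure_pair_iff.2 h
  have h1 : ∀ z : ℝ, ∃ m n : ℤ, |z - (m * a + n * b)| < ε := by
    intro z
    obtain ⟨w, hw, hzw⟩ := hd.exists_dist_lt z hε
    obtain ⟨m, n, hmn⟩ := AddSubgroup.mem_closure_pair.1 hw
    refine ⟨m, n, ?_⟩
    rw [Real.dist_eq, ← hmn] at hzw
    simpa using hzw
  choose m n hmn using h1
  have hcov : ∃ J : Finset ℝ, ∀ y ∈ Set.Icc 0 c, ∃ z ∈ J,
      |y - (m z * a + n z * b)| < ε := by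
    have := (isCompact_Icc (a := (0:ℝ)) (b := c)).elim_nhds_subcover
      (fun z => {y | |y - (m z * a + n z * b)| < ε}) (by
        intro z _
        apply IsOpen.mem_nhds
        · exact isOpen_lt (by fun_prop) (by fun_prop)
        · exact hmn z)
    obtain ⟨J, _, hJ⟩ := this
    refine ⟨J, fun y hy => ?_⟩
    have := hJ hy
    simpa using this
  obtain ⟨J, hJ⟩ := hcov
  set K : ℕ := ∑ z ∈ J, ((m z).natAbs + (n z).natAbs) with hK
  refine ⟨K * a + K * b, 2 * K, fun y hy hyc => ?_⟩
  obtain ⟨z, hz, hzy⟩ := hJ y ⟨hy, hyc⟩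
  have hb : (m z).natAbs + (n z).natAbs ≤ K :=
    Finset.single_le_sum (f := fun z => (m z).natAbs + (n z).natAbs) (fun _ _ => Nat.zero_le _) hz
  refine ⟨((K:ℤ) + m z).toNat, ((K:ℤ) + n z).toNat, by omega, by omega, ?_⟩
  have e1 : ((((K:ℤ) + m z).toNat : ℕ) : ℝ) = K + m z := by
    have : ((((K:ℤ) + m z).toNat : ℕ) : ℤ) = K + m z := Int.toNat_of_nonneg (by omega)
    exact_mod_cast this
  have e2 : ((((K:ℤ) + n z).toNat : ℕ) : ℝ) = K + n z := by
    have : ((((K:ℤ) + n z).toNat : ℕ) : ℤ) = K + n z := Int.toNat_of_nonneg (by omega)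
    exact_mod_cast this
  rw [e1, e2]
  refine le_trans (le_of_eq ?_) hzy.le
  congr 1; ring

lemma ren_ext {A : Type*} [Fintype A] (x p : A → ℝ) (hp : ∀ j, 0 < p j)
    (hpsum : ∑ j, p j = 1) (u : ℝ → ℝ) (hu0 : ∀ t, 0 ≤ u t) (hu1 : ∀ t, u t ≤ 1)
    (hsub : ∀ t, u t ≤ ∑ j, p j * u (t - x j)) (T δ K : ℝ) (hδ : 0 < δ) (hK : 0 ≤ K)
    (hδx : ∀ j, δ ≤ x j)
    (hlip : ∀ s t, s ≤ t → t ≤ T + δ → |u t - u s| ≤ K * (t - s)) :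
    ∃ g : ℝ → ℝ, ∃ K' : ℝ, 0 ≤ K' ∧ (∀ t, 0 ≤ g t) ∧ (∀ t, g t ≤ 1) ∧ (∀ t, u t ≤ g t) ∧
      (∀ t ≤ T, g t = u t) ∧ (∀ t, T + δ ≤ t → g t = ∑ j, p j * g (t - x j)) ∧
      (∀ s t, s ≤ t → |g t - g s| ≤ K' * (t - s)) := by
  set χ : ℝ → ℝ := fun t => max 0 (min 1 ((T + δ - t) / δ)) with hχ
  have χ0 : ∀ t, 0 ≤ χ t := fun t => le_max_left _ _
  have χ1 : ∀ t, χ t ≤ 1 := fun t => max_le zero_le_one (min_le_left _ _)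
  have χT : ∀ t ≤ T, χ t = 1 := by
    intro t ht
    have : 1 ≤ (T + δ - t) / δ := by rw [le_div_iff₀ hδ]; linarith
    simp [hχ, this]
  have χD : ∀ t, T + δ ≤ t → χ t = 0 := by
    intro t ht
    have : (T + δ - t) / δ ≤ 0 := div_nonpos_of_nonpos_of_nonneg (by linarith) hδ.le
    simp only [hχ]
    apply max_eq_left
    exact (min_le_right _ _).trans this
  have χL : ∀ s t, s ≤ t → |χ t - χ s| ≤ (t - s) / δ := by
    intro s t hst
    have h1 : |χ t - χ s| ≤ |(T + δ - t) / δ - (T + δ - s) / δ| := by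
      refine (abs_max_sub_max_le_max _ _ _ _).trans ?_
      simp only [sub_self, abs_zero]
      apply max_le (abs_nonneg _)
      refine (abs_min_sub_min_le_max _ _ _ _).trans ?_
      simp
    refine h1.trans (le_of_eq ?_)
    rw [← sub_div, abs_div, abs_of_pos hδ, abs_of_nonpos (by linarith)]
    ring
  set Q : (ℝ → ℝ) → ℝ → ℝ := fun f t => χ t * u t + (1 - χ t) * ∑ j, p j * f (t - x j) with hQ
  have Qmono : ∀ f f' : ℝ → ℝ, (∀ t, f t ≤ f' t) → ∀ t, Q f t ≤ Q f' t := by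
    intro f f' h t
    simp only [hQ]
    have := χ1 t
    have h2 : ∑ j, p j * f (t - x j) ≤ ∑ j, p j * f' (t - x j) :=
      Finset.sum_le_sum fun j _ => mul_le_mul_of_nonneg_left (h _) (hp j).le
    have := mul_le_mul_of_nonneg_left h2 (by linarith : 0 ≤ 1 - χ t)
    linarith
  have Q0 : ∀ f : ℝ → ℝ, (∀ t, 0 ≤ f t) → ∀ t, 0 ≤ Q f t := by
    intro f h t
    simp only [hQ]
    have := χ1 t
    have h2 : 0 ≤ ∑ j, p j * f (t - x j) :=
      Finset.sum_nonneg fun j _ => mul_nonneg (hp j).le (h _)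
    have := mul_nonneg (by linarith : 0 ≤ 1 - χ t) h2
    have := mul_nonneg (χ0 t) (hu0 t)
    linarith
  have Q1 : ∀ f : ℝ → ℝ, (∀ t, f t ≤ 1) → ∀ t, Q f t ≤ 1 := by
    intro f h t
    simp only [hQ]
    have := χ1 t
    have h2 : ∑ j, p j * f (t - x j) ≤ 1 := by
      rw [← hpsum]
      exact Finset.sum_le_sum fun j _ => by nlinarith [h (t - x j), hp j]
    have := mul_le_mul_of_nonneg_left h2 (by linarith : 0 ≤ 1 - χ t)
    have := mul_le_mul_of_nonneg_left (hu1 t) (χ0 t)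
    linarith
  set G : ℕ → ℝ → ℝ := fun n => Q^[n] (fun _ => 0) with hG
  have Gs : ∀ n, G (n+1) = Q (G n) := fun n => Function.iterate_succ_apply' _ _ _
  have G0 : ∀ n t, 0 ≤ G n t := by
    intro n
    induction n with
    | zero => intro t; simp [hG]
    | succ n ih => rw [Gs]; exact Q0 _ ih
  have G1 : ∀ n t, G n t ≤ 1 := by
    intro n
    induction n with
    | zero => intro t; simp [hG]
    | succ n ih => rw [Gs]; exact Q1 _ ih
  have Gm : ∀ n t, G n t ≤ G (n+1) t := by
    intro n
    induction n with
    | zero => intro t; exact (by simp [hG] : G 0 t = 0).le.trans (G0 1 t)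
    | succ n ih => intro t; rw [Gs (n+1)]; nth_rw 1 [Gs n]; exact Qmono _ _ ih t
  have Gmono : ∀ t, Monotone (fun n => G n t) := fun t => monotone_nat_of_le_succ fun n => Gm n t
  set g : ℝ → ℝ := fun t => ⨆ n, G n t with hg
  have gt : ∀ t, Tendsto (fun n => G n t) atTop (𝓝 (g t)) := fun t =>
    tendsto_atTop_ciSup (Gmono t) ⟨1, by rintro _ ⟨n, rfl⟩; exact G1 n t⟩
  have gQ : ∀ t, g t = χ t * u t + (1 - χ t) * ∑ j, p j * g (t - x j) := by
    intro t
    have h1 : Tendsto (fun n => G (n+1) t) atTop (𝓝 (g t)) := (tendsto_add_atTop_iff_nat 1).2 (gt t)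
    have h2 : Tendsto (fun n => G (n+1) t) atTop
        (𝓝 (χ t * u t + (1 - χ t) * ∑ j, p j * g (t - x j))) := by
      simp only [Gs]
      exact tendsto_const_nhds.add (tendsto_const_nhds.mul
        (tendsto_finsetSum _ fun j _ => tendsto_const_nhds.mul (gt _)))
    exact tendsto_nhds_unique h1 h2
  have g0 : ∀ t, 0 ≤ g t := fun t => ge_of_tendsto' (gt t) fun n => G0 n t
  have g1 : ∀ t, g t ≤ 1 := fun t => le_of_tendsto' (gt t) fun n => G1 n t
  have gT : ∀ t ≤ T, g t = u t := by
    intro t ht; rw [gQ, χT t ht]; ring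
  have gH : ∀ t, T + δ ≤ t → g t = ∑ j, p j * g (t - x j) := by
    intro t ht; rw [gQ, χD t ht]; ring
  have ind : ∀ t : ℝ, ∃ n : ℕ, t ≤ T + n * δ := by
    intro t
    obtain ⟨n, hn⟩ := exists_nat_ge ((t - T) / δ)
    exact ⟨n, by rw [div_le_iff₀ hδ] at hn; linarith⟩
  have gu : ∀ n : ℕ, ∀ t ≤ T + n * δ, u t ≤ g t := by
    intro n
    induction n with
    | zero => intro t ht; exact (gT t (by simpa using ht)).ge
    | succ n ih =>
      intro t ht
      push_cast at ht
      have h2 : ∑ j, p j * u (t - x j) ≤ ∑ j, p j * g (t - x j) :=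
        Finset.sum_le_sum fun j _ => mul_le_mul_of_nonneg_left
          (ih _ (by linarith [hδx j])) (hp j).le
      have h3 := (hsub t).trans h2
      rw [gQ]
      have := χ1 t
      have := mul_le_mul_of_nonneg_left h3 (by linarith : 0 ≤ 1 - χ t)
      linarith
  have Plip : ∀ s t C, (∀ j, |g (t - x j) - g (s - x j)| ≤ C) →
      |∑ j, p j * g (t - x j) - ∑ j, p j * g (s - x j)| ≤ C := by
    intro s t C h
    rw [← Finset.sum_sub_distrib]
    refine (Finset.abs_sum_le_sum_abs _ _).trans ?_
    have : C = ∑ j, p j * C := by rw [← Finset.sum_mul, hpsum, one_mul]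
    rw [this]
    refine Finset.sum_le_sum fun j _ => ?_
    rw [← mul_sub, abs_mul, abs_of_pos (hp j)]
    exact mul_le_mul_of_nonneg_left (h j) (hp j).le
  set K' := K + K + 1 / δ with hK'
  have hK'0 : 0 ≤ K' := by positivity
  have L0 : ∀ s t, s ≤ t → t ≤ T + δ → |g t - g s| ≤ K' * (t - s) := by
    intro s t hst ht
    have hP := Plip s t (K * (t - s)) (fun j => by
      rw [gT _ (by linarith [hδx j]), gT _ (by linarith [hδx j])]
      have := hlip (s - x j) (t - x j) (by linarith) (by linarith [hδx j])
      refine this.trans (le_of_eq (by ring)))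
    have hU := hlip s t hst ht
    have hC := χL s t hst
    have hP0 : 0 ≤ ∑ j, p j * g (s - x j) :=
      Finset.sum_nonneg fun j _ => mul_nonneg (hp j).le (g0 _)
    have hP1 : ∑ j, p j * g (s - x j) ≤ 1 := by
      rw [← hpsum]
      exact Finset.sum_le_sum fun j _ => by nlinarith [g1 (s - x j), hp j]
    rw [gQ t, gQ s]
    set a := ∑ j, p j * g (t - x j)
    set b := ∑ j, p j * g (s - x j)
    have e : χ t * u t + (1 - χ t) * a - (χ s * u s + (1 - χ s) * b) =
      χ t * (u t - u s) + (1 - χ t) * (a - b) + (χ t - χ s) * (u s - b) := by ring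
    rw [e]
    have hd : 0 ≤ t - s := by linarith
    have n1 : |χ t * (u t - u s)| ≤ K * (t - s) := by
      rw [abs_mul, abs_of_nonneg (χ0 t)]
      nlinarith [χ1 t, χ0 t, abs_nonneg (u t - u s)]
    have n2 : |(1 - χ t) * (a - b)| ≤ K * (t - s) := by
      rw [abs_mul, abs_of_nonneg (by linarith [χ1 t])]
      nlinarith [χ1 t, χ0 t, abs_nonneg (a - b)]
    have n3 : |(χ t - χ s) * (u s - b)| ≤ (t - s) / δ := by
      rw [abs_mul]
      have : |u s - b| ≤ 1 := abs_le.2 ⟨by linarith [hu0 s], by linarith [hu1 s]⟩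
      nlinarith [abs_nonneg (χ t - χ s), abs_nonneg (u s - b)]
    refine (abs_add_three _ _ _).trans ?_
    have : K' * (t - s) = K * (t - s) + K * (t - s) + (t - s) / δ := by rw [hK']; ring
    linarith
  have L1 : ∀ n : ℕ, ∀ s t, s ≤ t → t ≤ T + δ + n * δ → |g t - g s| ≤ K' * (t - s) := by
    intro n
    induction n with
    | zero => intro s t hst ht; exact L0 s t hst (by simpa using ht)
    | succ n ih =>
      have key : ∀ s t, s ≤ t → T + δ ≤ s → t ≤ T + δ + (n+1) * δ → |g t - g s| ≤ K' * (t - s) := by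
        intro s t hst hs ht
        rw [gH t (by linarith), gH s hs]
        apply Plip
        intro j
        refine (ih (s - x j) (t - x j) (by linarith) (by linarith [hδx j])).trans (le_of_eq (by ring))
      intro s t hst ht
      push_cast at ht
      by_cases h1 : t ≤ T + δ
      · exact L0 s t hst h1
      by_cases h2 : T + δ ≤ s
      · exact key s t hst h2 ht
      push Not at h1 h2
      have a1 := key (T + δ) t h1.le le_rfl ht
      have a2 := L0 s (T + δ) h2.le le_rfl
      have := abs_sub_le (g t) (g (T + δ)) (g s)
      linarith
  refine ⟨g, K', hK'0, g0, g1, fun t => ?_, gT, gH, fun s t hst => ?_⟩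
  · obtain ⟨n, hn⟩ := ind t; exact gu n t hn
  · obtain ⟨n, hn⟩ := ind t; exact L1 n s t hst (by linarith)

lemma ren_const {A : Type*} [Fintype A] (x p : A → ℝ)
    (hpsum : ∑ j, p j = 1) (g : ℝ → ℝ) (hg : Continuous g) (T : ℝ)
    (hH : ∀ t, T ≤ t → g t = ∑ j, p j * g (t - x j)) (t : ℝ) (ht : T ≤ t) :
    ∑ j, p j * ∫ s in (t - x j)..t, g s = ∑ j, p j * ∫ s in (T - x j)..T, g s := by
  set Φ : ℝ → ℝ := fun t => ∫ s in (0:ℝ)..t, g s with hΦ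
  have hd : ∀ t, HasDerivAt Φ (g t) t := fun t =>
    intervalIntegral.integral_hasDerivAt_right (hg.intervalIntegrable _ _)
      hg.stronglyMeasurable.stronglyMeasurableAtFilter hg.continuousAt
  have e : ∀ t, ∑ j, p j * ∫ s in (t - x j)..t, g s = ∑ j, p j * (Φ t - Φ (t - x j)) := by
    intro t
    refine Finset.sum_congr rfl fun j _ => ?_
    rw [hΦ]
    simp only
    rw [intervalIntegral.integral_interval_sub_left (hg.intervalIntegrable _ _)
      (hg.intervalIntegrable _ _)]
  rw [e, e]
  have hI : ∀ s, HasDerivAt (fun t => ∑ j, p j * (Φ t - Φ (t - x j)))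
      (∑ j, p j * (g s - g (s - x j))) s := by
    intro s
    have := HasDerivAt.fun_sum (u := Finset.univ) (A := fun j t => p j * (Φ t - Φ (t - x j)))
      (A' := fun j => p j * (g s - g (s - x j))) (x := s) (fun j _ => by
        apply HasDerivAt.const_mul
        exact (hd s).sub ((hd (s - x j)).comp_sub_const s (x j)))
    exact this
  refine constant_of_has_deriv_right_zero (f := fun t => ∑ j, p j * (Φ t - Φ (t - x j)))
    (a := T) (b := t) ?_ ?_ t ⟨ht, le_rfl⟩
  · exact fun s _ => (hI s).continuousAt.continuousWithinAt
  · intro s hs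
    have : ∑ j, p j * (g s - g (s - x j)) = 0 := by
      simp only [mul_sub, Finset.sum_sub_distrib, ← Finset.sum_mul]
      rw [hpsum, ← hH s hs.1]; ring
    have h := hI s
    rw [this] at h
    exact h.hasDerivWithinAt

lemma ren_step {A : Type*} [Fintype A] (x p : A → ℝ) (hx : ∀ j, 0 < x j) (hp : ∀ j, 0 < p j)
    (hpsum : ∑ j, p j = 1) (g : ℝ → ℝ) (T B : ℝ)
    (hH : ∀ t, T ≤ t → g t = ∑ j, p j * g (t - x j)) (hB : ∀ t, T ≤ t → g t ≤ B)
    (a : A) (n : ℕ) : ∀ t, T + (∑ j, x j) + n * x a ≤ t →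
      p a ^ n * (B - g (t - n * x a)) ≤ B - g t := by
  have hc : ∀ j, x j ≤ ∑ j, x j := fun j =>
    Finset.single_le_sum (fun i _ => (hx i).le) (Finset.mem_univ j)
  have hc0 : 0 ≤ ∑ j, x j := Finset.sum_nonneg fun j _ => (hx j).le
  induction n with
  | zero => intro t ht; simp
  | succ n ih =>
    intro t ht
    push_cast at ht
    have hxa := hx a
    have hn : 0 ≤ n * x a := by positivity
    have h1 := ih (t - x a) (by linarith)
    have h2 : p a * (B - g (t - x a)) ≤ B - g t := by
      have : B - g t = ∑ j, p j * (B - g (t - x j)) := by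
        simp only [mul_sub, Finset.sum_sub_distrib, ← Finset.sum_mul]
        rw [hpsum, ← hH t (by linarith)]; ring
      rw [this]
      exact Finset.single_le_sum (f := fun j => p j * (B - g (t - x j)))
        (fun j _ => mul_nonneg (hp j).le
          (sub_nonneg.2 (hB _ (by linarith [hc j])))) (Finset.mem_univ a)
    have e : t - ((n + 1 : ℕ) : ℝ) * x a = t - x a - n * x a := by push_cast; ring
    rw [e, pow_succ', mul_assoc]
    exact (mul_le_mul_of_nonneg_left h1 (hp a).le).trans h2

lemma ren_limit {A : Type*} [Fintype A] (x p : A → ℝ) (hx : ∀ j, 0 < x j) (hp : ∀ j, 0 < p j)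
    (hp1 : ∀ j, p j ≤ 1)
    (hpsum : ∑ j, p j = 1) (a b : A) (hirr : Irrational (x a / x b)) (g : ℝ → ℝ)
    (g0 : ∀ t, 0 ≤ g t) (g1 : ∀ t, g t ≤ 1) (T K : ℝ) (hK : 0 ≤ K)
    (hH : ∀ t, T ≤ t → g t = ∑ j, p j * g (t - x j))
    (hlip : ∀ s t, s ≤ t → |g t - g s| ≤ K * (t - s)) (η : ℝ) (hη : 0 < η) :
    ∀ᶠ t in atTop, g t * (∑ j, p j * x j) ≤ (∑ j, p j * ∫ s in (T - x j)..T, g s) + η := by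
  have hlip' : ∀ s t, |g t - g s| ≤ K * |t - s| := by
    intro s t
    rcases le_total s t with h | h
    · rw [abs_of_nonneg (sub_nonneg.2 h)]; exact hlip s t h
    · rw [abs_sub_comm, abs_sub_comm t s, abs_of_nonneg (sub_nonneg.2 h)]; exact hlip t s h
  have hgc : Continuous g := by
    have : LipschitzWith ⟨K, hK⟩ g := LipschitzWith.of_dist_le_mul fun s t => by
      rw [Real.dist_eq, Real.dist_eq]; exact hlip' t s
    exact this.continuous
  set c := ∑ j, x j with hcdef
  have hc : ∀ j, x j ≤ c := fun j =>
    Finset.single_le_sum (fun i _ => (hx i).le) (Finset.mem_univ j)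
  have hc0 : 0 ≤ c := Finset.sum_nonneg fun j _ => (hx j).le
  set E := ∑ j, p j * x j with hE
  have hE0 : 0 < E := Finset.sum_pos (fun j _ => mul_pos (hp j) (hx j)) ⟨a, Finset.mem_univ a⟩
  set I := ∑ j, p j * ∫ s in (T - x j)..T, g s with hI
  have bd : IsBoundedUnder (· ≤ ·) atTop g := isBoundedUnder_of ⟨1, g1⟩
  have cbd : IsCoboundedUnder (· ≤ ·) atTop g :=
    (isBoundedUnder_of ⟨0, g0⟩ : IsBoundedUnder (· ≥ ·) atTop g).isCoboundedUnder_le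
  set M := limsup g atTop with hM
  have main : ∀ η > 0, (M - η) * E ≤ I := by
    intro η hη
    obtain ⟨s, N, hs⟩ := ren_density (x a) (x b) hirr c (η / (2 * (K + 1))) (by positivity)
    set q := (p a * p b) ^ N with hq
    have hq0 : 0 < q := pow_pos (mul_pos (hp a) (hp b)) _
    set ε := q * η / 4 with hε
    have hε0 : 0 < ε := by positivity
    have ev := eventually_lt_of_limsup_lt (f := atTop) (u := g) (b := M + ε) (by linarith) bd
    have fr := frequently_lt_of_lt_limsup (f := atTop) (u := g) (b := M - ε) cbd (by linarith)
    obtain ⟨t1, ht1⟩ := eventually_atTop.1 ev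
    set T2 := max t1 T with hT2
    have hB : ∀ t, T2 ≤ t → g t ≤ M + ε := fun t ht => (ht1 t ((le_max_left _ _).trans ht)).le
    have hH2 : ∀ t, T2 ≤ t → g t = ∑ j, p j * g (t - x j) := fun t ht =>
      hH t ((le_max_right _ _).trans ht)
    obtain ⟨t, htM, ht⟩ := (fr.and_eventually
      (eventually_ge_atTop (T2 + c + N * x a + N * x b + |s|))).exists
    have hlow : ∀ z, t - s - c ≤ z → z ≤ t - s → M - η ≤ g z := by
      intro z hz1 hz2
      obtain ⟨k, l, hk, hl, hkl⟩ := hs (t - s - z) (by linarith) (by linarith)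
      have hk' : k * x a ≤ N * x a := mul_le_mul_of_nonneg_right (by exact_mod_cast hk) (hx a).le
      have hl' : l * x b ≤ N * x b := mul_le_mul_of_nonneg_right (by exact_mod_cast hl) (hx b).le
      have hs0 := abs_nonneg s
      have s1 := ren_step x p hx hp hpsum g T2 (M + ε) hH2 hB a k t (by
        have : 0 ≤ N * x b := mul_nonneg (by positivity) (hx b).le
        linarith)
      have s2 := ren_step x p hx hp hpsum g T2 (M + ε) hH2 hB b l (t - k * x a) (by linarith)
      set w := t - k * x a - l * x b with hw
      have hD : 0 ≤ M + ε - g w := sub_nonneg.2 (hB w (by linarith))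
      have hqk : q ≤ p a ^ k * p b ^ l := by
        rw [hq, mul_pow]
        exact mul_le_mul (pow_le_pow_of_le_one (hp a).le (hp1 a) hk)
          (pow_le_pow_of_le_one (hp b).le (hp1 b) hl) (pow_pos (hp b) _).le (pow_pos (hp a) _).le
      have s3 : q * (M + ε - g w) ≤ 2 * ε := by
        calc q * (M + ε - g w) ≤ p a ^ k * p b ^ l * (M + ε - g w) :=
              mul_le_mul_of_nonneg_right hqk hD
          _ = p a ^ k * (p b ^ l * (M + ε - g w)) := by ring
          _ ≤ p a ^ k * (M + ε - g (t - k * x a)) :=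
              mul_le_mul_of_nonneg_left s2 (pow_pos (hp a) _).le
          _ ≤ M + ε - g t := s1
          _ ≤ 2 * ε := by linarith
      have s4 : M + ε - g w ≤ η / 2 := by
        have : 2 * ε = q * (η / 2) := by rw [hε]; ring
        rw [this] at s3
        exact le_of_mul_le_mul_left s3 hq0
      have s5 : |g w - g z| ≤ η / 2 := by
        refine (hlip' z w).trans ?_
        have : |w - z| ≤ η / (2 * (K + 1)) := by
          have e : w - z = s + (t - s - z) - (k * x a + l * x b) := by rw [hw]; ring
          rw [e]; exact hkl
        calc K * |w - z| ≤ (K + 1) * (η / (2 * (K + 1))) :=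
              mul_le_mul (by linarith) this (abs_nonneg _) (by linarith)
          _ = η / 2 := by field_simp
      have := (abs_le.1 s5).2
      linarith
    have hT : T ≤ t - s := by
      have : T ≤ T2 := le_max_right _ _
      have := le_abs_self s
      have : 0 ≤ N * x a := mul_nonneg (by positivity) (hx a).le
      have : 0 ≤ N * x b := mul_nonneg (by positivity) (hx b).le
      linarith
    rw [hI, ← ren_const x p hpsum g hgc T hH (t - s) hT, hE, Finset.mul_sum]
    refine Finset.sum_le_sum fun j _ => ?_
    have : ∫ z in (t - s - x j)..(t - s), (M - η) ≤ ∫ z in (t - s - x j)..(t - s), g z := by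
      apply intervalIntegral.integral_mono_on (by linarith [hx j]) (by simp)
        (hgc.intervalIntegrable _ _)
      intro z hz
      exact hlow z (by linarith [hz.1, hc j]) hz.2
    rw [intervalIntegral.integral_const] at this
    simp only [smul_eq_mul] at this
    have := mul_le_mul_of_nonneg_left this (hp j).le
    refine le_trans (le_of_eq ?_) this
    ring
  have hm := main (η / (2 * E)) (by positivity)
  have ev := eventually_lt_of_limsup_lt (f := atTop) (u := g) (b := M + η / (2 * E))
    (by have : 0 < η / (2 * E) := by positivity
        linarith) bd
  filter_upwards [ev] with t ht
  have h1 := mul_le_mul_of_nonneg_right ht.le hE0.le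
  have h2 : η / (2 * E) * E = η / 2 := by field_simp
  rw [sub_mul] at hm
  rw [add_mul] at h1
  linarith

lemma ren_main {A : Type*} [Fintype A] (x p : A → ℝ) (hx : ∀ j, 0 < x j) (hp : ∀ j, 0 < p j)
    (hp1 : ∀ j, p j ≤ 1)
    (hpsum : ∑ j, p j = 1) (a b : A) (hirr : Irrational (x a / x b))
    (u : ℝ → ℝ) (hu0 : ∀ t, 0 ≤ u t) (hu1 : ∀ t, u t ≤ 1)
    (hsub : ∀ t, u t ≤ ∑ j, p j * u (t - x j))
    (hlip : ∀ T, ∃ K, 0 ≤ K ∧ ∀ s t, s ≤ t → t ≤ T → |u t - u s| ≤ K * (t - s))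
    (havg : ∀ c, 0 ≤ c → Tendsto (fun T => ∫ t in (T - c)..T, u t) atTop (𝓝 0)) :
    Tendsto u atTop (𝓝 0) := by
  set c := ∑ j, x j with hcdef
  have hc : ∀ j, x j ≤ c := fun j =>
    Finset.single_le_sum (fun i _ => (hx i).le) (Finset.mem_univ j)
  have hc0 : 0 ≤ c := Finset.sum_nonneg fun j _ => (hx j).le
  set E := ∑ j, p j * x j with hE
  have hE0 : 0 < E := Finset.sum_pos (fun j _ => mul_pos (hp j) (hx j)) ⟨a, Finset.mem_univ a⟩
  have : ∀ η > 0, ∀ᶠ t in atTop, u t * E < η := by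
    intro η hη
    obtain ⟨δ0, hδ0, hdelta⟩ : ∃ δ0 : ℝ, 0 < δ0 ∧ ∀ j, δ0 ≤ x j := by
      have : Nonempty A := ⟨a⟩
      obtain ⟨j0, hj0⟩ := Finite.exists_min x
      exact ⟨x j0, hx j0, hj0⟩
    set δ := min δ0 (η / 4) with hδd
    have hδ : 0 < δ := lt_min hδ0 (by positivity)
    obtain ⟨T, hT⟩ := ((havg c hc0).eventually (gt_mem_nhds (by positivity : 0 < η / 4))).exists
    obtain ⟨K, hK, hKl⟩ := hlip (T + δ)
    obtain ⟨g, K', hK', g0, g1, ug, gT, gH, gl⟩ := ren_ext x p hp hpsum u hu0 hu1 hsub T δ K hδ hK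
      (fun j => (min_le_left _ _).trans (hdelta j)) hKl
    have hgc : Continuous g := by
      have : LipschitzWith ⟨K', hK'⟩ g := LipschitzWith.of_dist_le_mul fun s t => by
        rw [Real.dist_eq, Real.dist_eq]
        change _ ≤ K' * _
        rcases le_total s t with h | h
        · rw [abs_sub_comm, abs_sub_comm s t, abs_of_nonneg (sub_nonneg.2 h)]; exact gl s t h
        · rw [abs_of_nonneg (sub_nonneg.2 h)]; exact gl t s h
      exact this.continuous
    have ev := ren_limit x p hx hp hp1 hpsum a b hirr g g0 g1 (T + δ) K' hK' gH gl (η / 4)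
      (by positivity)
    have hI : ∑ j, p j * ∫ s in (T + δ - x j)..(T + δ), g s ≤ η / 4 + η / 4 := by
      have : ∀ j, ∫ s in (T + δ - x j)..(T + δ), g s ≤ η / 4 + η / 4 := by
        intro j
        have hgi : ∀ a b, IntervalIntegrable g volume a b := fun a b => hgc.intervalIntegrable _ _
        have h1 : ∫ s in (T + δ - x j)..(T + δ), g s ≤ ∫ s in (T - c)..(T + δ), g s := by
          rw [← intervalIntegral.integral_add_adjacent_intervals (hgi (T - c) (T + δ - x j)) (hgi _ _)]
          have := intervalIntegral.integral_nonneg (μ := volume) (f := g) (a := T - c) (b := T + δ - x j)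
            (by linarith [hc j]) (fun z _ => g0 z)
          linarith
        rw [← intervalIntegral.integral_add_adjacent_intervals (hgi (T - c) T) (hgi _ _)] at h1
        have h2 : ∫ s in (T - c)..T, g s = ∫ s in (T - c)..T, u s := by
          apply intervalIntegral.integral_congr
          intro z hz
          rw [Set.uIcc_of_le (by linarith)] at hz
          exact gT z hz.2
        have h3 : ∫ s in T..(T + δ), g s ≤ ∫ s in T..(T + δ), (1:ℝ) :=
          intervalIntegral.integral_mono_on (by linarith) (hgi _ _) (by simp) (fun z _ => g1 z)
        rw [intervalIntegral.integral_const] at h3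
        simp only [smul_eq_mul] at h3
        have : δ ≤ η / 4 := min_le_right _ _
        linarith
      calc ∑ j, p j * ∫ s in (T + δ - x j)..(T + δ), g s ≤ ∑ j, p j * (η / 4 + η / 4) :=
            Finset.sum_le_sum fun j _ => mul_le_mul_of_nonneg_left (this j) (hp j).le
        _ = _ := by rw [← Finset.sum_mul, hpsum, one_mul]
    filter_upwards [ev] with t ht
    have := mul_le_mul_of_nonneg_right (ug t) hE0.le
    linarith
  rw [Metric.tendsto_atTop']
  intro ε hε
  obtain ⟨N, hN⟩ := eventually_atTop.1 (this (ε * E) (by positivity))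
  refine ⟨N, fun t ht => ?_⟩
  rw [Real.dist_eq, sub_zero, abs_of_nonneg (hu0 t)]
  exact lt_of_mul_lt_mul_right (hN t ht.le) hE0.le

lemma fs_norm (b : ℝ) : ‖Complex.exp (Complex.I * b)‖ = 1 := by
  rw [mul_comm]; exact Complex.norm_exp_ofReal_mul_I b

lemma fs_osc (b : ℝ) (hb : b ≠ 0) (c : ℝ) (hc : 0 ≤ c) (T : ℝ) :
    ‖∫ t in (T - c)..T, Complex.exp (Complex.I * (b * Real.exp t : ℝ))‖
      ≤ (2 + c) * Real.exp (-(T - c)) / |b| := by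
  have hbc : (b : ℂ) ≠ 0 := by exact_mod_cast hb
  set k : ℂ := Complex.I * b with hk
  have hk0 : k ≠ 0 := mul_ne_zero Complex.I_ne_zero hbc
  have hkn : ‖k‖ = |b| := by simp [hk]
  set f : ℝ → ℂ := fun t => Complex.exp (Complex.I * (b * Real.exp t : ℝ)) with hf
  set h : ℝ → ℂ := fun t => f t * (Real.exp (-t) : ℝ) / k with hh
  have hfc : Continuous f := by fun_prop
  have hhc : Continuous h := by fun_prop
  have hfn : ∀ t, ‖f t‖ = 1 := fun t => fs_norm _
  have hhn : ∀ t, T - c ≤ t → ‖h t‖ ≤ Real.exp (-(T - c)) / |b| := by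
    intro t ht
    simp only [hh]
    rw [norm_div, norm_mul, hfn, hkn, one_mul, Complex.norm_real, Real.norm_eq_abs, Real.abs_exp]
    gcongr
  have hd : ∀ t, HasDerivAt h (f t - h t) t := by
    intro t
    have h1 : HasDerivAt (fun t : ℝ => ((b * Real.exp t : ℝ) : ℂ)) ((b * Real.exp t : ℝ) : ℂ) t :=
      ((Real.hasDerivAt_exp t).const_mul b).ofReal_comp
    have h2 : HasDerivAt f (f t * (Complex.I * (b * Real.exp t : ℝ))) t :=
      (h1.const_mul Complex.I).cexp
    have h3 : HasDerivAt (fun t : ℝ => ((Real.exp (-t) : ℝ) : ℂ)) ((Real.exp (-t) * (-1) : ℝ) : ℂ) t :=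
      ((hasDerivAt_neg t).exp).ofReal_comp
    have h4 := (h2.mul h3).div_const k
    refine h4.congr_deriv ?_
    simp only [hh]
    push_cast
    have he : Complex.exp t * Complex.exp (-t) = 1 := by rw [← Complex.exp_add]; simp
    symm
    rw [sub_eq_iff_eq_add, ← add_div, eq_div_iff hk0]
    linear_combination (-f t * Complex.I * b) * he + f t * hk
  have hF := intervalIntegral.integral_eq_sub_of_hasDerivAt (a := T - c) (b := T)
    (fun t _ => hd t) ((hfc.sub hhc).intervalIntegrable _ _)
  rw [intervalIntegral.integral_sub (hfc.intervalIntegrable _ _) (hhc.intervalIntegrable _ _)] at hF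
  have hI : ‖∫ t in (T - c)..T, h t‖ ≤ Real.exp (-(T - c)) / |b| * |T - (T - c)| := by
    apply intervalIntegral.norm_integral_le_of_norm_le_const
    intro t ht
    rw [Set.uIoc_of_le (by linarith)] at ht
    exact hhn t ht.1.le
  have e : ∫ t in (T - c)..T, f t = h T - h (T - c) + ∫ t in (T - c)..T, h t := by
    rw [← hF]; ring
  rw [e]
  rw [sub_sub_cancel, abs_of_nonneg hc] at hI
  have := hhn T (by linarith)
  have := hhn (T - c) le_rfl
  refine (norm_add_le _ _).trans ?_
  have := norm_sub_le (h T) (h (T - c))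
  have e2 : (2 + c) * Real.exp (-(T - c)) / |b| = Real.exp (-(T - c)) / |b|
    + Real.exp (-(T - c)) / |b| + Real.exp (-(T - c)) / |b| * c := by ring
  linarith

lemma fs_normSq (μ : Measure ℝ) [IsProbabilityMeasure μ] (ξ : ℝ) :
    ((‖∫ y, Complex.exp (Complex.I * (-(2 * Real.pi * ξ * y) : ℝ)) ∂μ‖ ^ 2 : ℝ) : ℂ) =
      ∫ z : ℝ × ℝ, Complex.exp (Complex.I * (2 * Real.pi * (z.2 - z.1) * ξ : ℝ)) ∂(μ.prod μ) := by
  have := integral_prod_mul (μ := μ) (ν := μ)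
    (fun y : ℝ => Complex.exp (Complex.I * (-(2 * Real.pi * ξ * y) : ℝ)))
    (fun y : ℝ => (starRingEnd ℂ) (Complex.exp (Complex.I * (-(2 * Real.pi * ξ * y) : ℝ))))
  rw [integral_conj, Complex.mul_conj'] at this
  rw [Complex.ofReal_pow, ← this]
  congr 1
  ext z
  rw [← Complex.exp_conj, ← Complex.exp_add]
  congr 1
  rw [map_mul, Complex.conj_I, Complex.conj_ofReal]
  push_cast
  ring

lemma fs_avg (μ : Measure ℝ) [IsProbabilityMeasure μ] (hat : ∀ y, μ {y} = 0) (c : ℝ) (hc : 0 ≤ c) :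
    Tendsto (fun T : ℝ => ∫ t in (T - c)..T,
      ‖∫ y, Complex.exp (Complex.I * (-(2 * Real.pi * Real.exp t * y) : ℝ)) ∂μ‖ ^ 2) atTop (𝓝 0) := by
  have key : ∀ T : ℝ, ((∫ t in (T - c)..T,
      ‖∫ y, Complex.exp (Complex.I * (-(2 * Real.pi * Real.exp t * y) : ℝ)) ∂μ‖ ^ 2 : ℝ) : ℂ) =
      ∫ z : ℝ × ℝ, (∫ t in (T - c)..T,
        Complex.exp (Complex.I * (2 * Real.pi * (z.2 - z.1) * Real.exp t : ℝ))) ∂(μ.prod μ) := by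
    intro T
    rw [← intervalIntegral.integral_ofReal]
    simp only [fs_normSq]
    apply intervalIntegral_integral_swap
    have hfm : IsFiniteMeasure (volume.restrict (Set.uIoc (T - c) T)) :=
      ⟨by rw [Measure.restrict_apply_univ, Set.uIoc]; exact measure_Ioc_lt_top⟩
    refine Integrable.of_bound (C := 1) ?_ ?_
    · apply Continuous.aestronglyMeasurable
      simp only [Function.uncurry_def]
      fun_prop
    · refine Eventually.of_forall fun z => ?_
      simp only [Function.uncurry_def]
      exact (fs_norm _).le
  have hlim : Tendsto (fun T : ℝ => ∫ z : ℝ × ℝ, (∫ t in (T - c)..T,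
        Complex.exp (Complex.I * (2 * Real.pi * (z.2 - z.1) * Real.exp t : ℝ))) ∂(μ.prod μ))
        atTop (𝓝 (∫ z : ℝ × ℝ, (0:ℂ) ∂(μ.prod μ))) := by
    apply tendsto_integral_filter_of_dominated_convergence (fun _ => c)
    · refine Eventually.of_forall fun T => ?_
      apply Continuous.aestronglyMeasurable
      apply intervalIntegral.continuous_parametric_intervalIntegral_of_continuous'
      simp only [Function.uncurry_def]
      fun_prop
    · refine Eventually.of_forall fun T => Eventually.of_forall fun z => ?_
      have := intervalIntegral.norm_integral_le_of_norm_le_const (a := T - c) (b := T) (C := 1)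
        (f := fun t : ℝ => Complex.exp (Complex.I * (2 * Real.pi * (z.2 - z.1) * Real.exp t : ℝ)))
        (fun t _ => (fs_norm _).le)
      rwa [sub_sub_cancel, abs_of_nonneg hc, one_mul] at this
    · exact integrable_const _
    · have hne : ∀ᵐ z ∂(μ.prod μ), z.2 - z.1 ≠ 0 := by
        have hm : MeasurableSet {z : ℝ × ℝ | z.2 - z.1 ≠ 0} := by
          apply IsOpen.measurableSet
          exact isOpen_ne_fun (by fun_prop) (by fun_prop)
        refine (Measure.ae_prod_mem_iff_ae_ae_mem hm).2 (Eventually.of_forall fun y => ?_)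
        have : ∀ᵐ z ∂μ, z ≠ y := by
          rw [ae_iff]; simpa using hat y
        filter_upwards [this] with z hz
        exact sub_ne_zero.2 hz
      filter_upwards [hne] with z hz
      have hb : 2 * Real.pi * (z.2 - z.1) ≠ 0 := mul_ne_zero (by positivity) hz
      apply squeeze_zero_norm (fun T => fs_osc _ hb c hc T)
      have h1 : Tendsto (fun T : ℝ => Real.exp (-(T - c))) atTop (𝓝 0) :=
        Real.tendsto_exp_neg_atTop_nhds_zero.comp (tendsto_atTop_add_const_right _ (-c) tendsto_id)
      have := (h1.const_mul (2 + c)).div_const |2 * Real.pi * (z.2 - z.1)|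
      simpa using this
  simp only [← key, integral_zero] at hlim
  exact_mod_cast (Complex.continuous_re.tendsto _).comp hlim

lemma fs_noatom {A : Type*} [Fintype A] (r b p : A → ℝ)
    (hr : ∀ j, 0 < r j ∧ r j < 1) (hp : ∀ j, 0 < p j ∧ p j < 1)
    (hpsum : ∑ j, p j = 1)
    (F : Set ℝ) (hFc : IsCompact F) (hFne : F.Nonempty)
    (hFss : F = ⋃ j, (fun y => r j * y + b j) '' F)
    (hFns : ¬ ∃ y, F = {y})
    (μ : Measure ℝ) [IsProbabilityMeasure μ]
    (hss : μ = ∑ j, ENNReal.ofReal (p j) • Measure.map (fun y => r j * y + b j) μ) (y0 : ℝ) :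
    μ {y0} = 0 := by
  by_contra hy0
  have hS : {y : ℝ | μ {y0} ≤ μ {y}}.Finite :=
    Measure.finite_const_le_meas_of_disjoint_iUnion μ (pos_iff_ne_zero.2 hy0)
      (As := fun y : ℝ => {y}) (fun y => measurableSet_singleton y)
      (fun a b hab => by simpa [Function.onFun] using hab) (measure_ne_top _ _)
  obtain ⟨y1, hy1, hmax⟩ := Set.exists_max_image _ (fun y => μ {y}) hS ⟨y0, (le_refl (μ {y0}) : _)⟩
  have hmax' : ∀ y, μ {y} ≤ μ {y1} := by
    intro y
    by_cases h : μ {y0} ≤ μ {y}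
    · exact hmax y h
    · exact (not_le.1 h).le.trans hy1
  have hpre : ∀ j y, (fun y => r j * y + b j) ⁻¹' {y} = {(y - b j) / r j} := by
    intro j y
    ext z
    have := (hr j).1.ne'
    simp only [Set.mem_preimage, Set.mem_singleton_iff]
    rw [eq_div_iff this]
    constructor <;> intro h <;> linarith
  have hsum : ∀ y, μ.real {y} = ∑ j, p j * μ.real {(y - b j) / r j} := by
    intro y
    have h : μ {y} = ∑ j, ENNReal.ofReal (p j) * μ {(y - b j) / r j} := by
      conv_lhs => rw [hss]
      rw [Measure.finsetSum_apply]
      refine Finset.sum_congr rfl fun j _ => ?_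
      rw [Measure.smul_apply, Measure.map_apply (by fun_prop) (measurableSet_singleton y), hpre,
        smul_eq_mul]
    rw [Measure.real, h, ENNReal.toReal_sum (fun j _ => ENNReal.mul_ne_top ENNReal.ofReal_ne_top (measure_ne_top _ _))]
    refine Finset.sum_congr rfl fun j _ => ?_
    rw [ENNReal.toReal_mul, ENNReal.toReal_ofReal (hp j).1.le, Measure.real]
  have hmaxr : ∀ y, μ.real {y} ≤ μ.real {y1} := fun y =>
    ENNReal.toReal_mono (measure_ne_top _ _) (hmax' y)
  have hinv : ∀ y, μ.real {y} = μ.real {y1} → ∀ j, μ.real {(y - b j) / r j} = μ.real {y1} := by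
    intro y hy j
    have h0 : ∑ j, p j * (μ.real {y1} - μ.real {(y - b j) / r j}) = 0 := by
      simp only [mul_sub, Finset.sum_sub_distrib, ← Finset.sum_mul]
      rw [hpsum, ← hsum, hy]; ring
    have h1 := (Finset.sum_eq_zero_iff_of_nonneg (fun j _ =>
      mul_nonneg (hp j).1.le (sub_nonneg.2 (hmaxr _)))).1 h0 j (Finset.mem_univ j)
    rcases mul_eq_zero.1 h1 with h | h
    · exact absurd h (hp j).1.ne'
    · linarith
  have hS2 : {y : ℝ | μ.real {y} = μ.real {y1}}.Finite := by
    refine hS.subset fun y hy => ?_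
    have : μ {y} = μ {y1} := (ENNReal.toReal_eq_toReal_iff' (measure_ne_top _ _) (measure_ne_top _ _)).1 hy
    simp only [Set.mem_ofPred_eq]
    rw [this]; exact hy1
  have hfix : ∀ j, r j * y1 + b j = y1 := by
    intro j
    have hrj := hr j
    have h1r : 0 < 1 - r j := by linarith
    set q := b j / (1 - r j) with hq
    have hqb : b j = q * (1 - r j) := by rw [hq]; field_simp
    obtain ⟨w, hw, hwm⟩ := Set.exists_max_image _ (fun y => |y - q|) hS2 ⟨y1, rfl⟩
    have h2 := hwm _ (hinv w hw j)
    have e : (w - b j) / r j - q = (w - q) / r j := by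
      rw [hqb, eq_div_iff hrj.1.ne', sub_mul, div_mul_cancel₀ _ hrj.1.ne']; ring
    simp only [e] at h2
    rw [abs_div, abs_of_pos hrj.1, div_le_iff₀ hrj.1] at h2
    have h3 : |w - q| = 0 := by nlinarith [abs_nonneg (w - q)]
    have h4 := hwm y1 rfl
    simp only [h3] at h4
    have h5 : y1 - q = 0 := abs_eq_zero.1 (le_antisymm h4 (abs_nonneg _))
    have : y1 = q := by linarith
    rw [hqb, this]; ring
  apply hFns
  refine ⟨y1, ?_⟩
  obtain ⟨w, hw, hwm⟩ := hFc.exists_isMaxOn hFne (f := fun y => |y - y1|) (by fun_prop)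
  have hw0 : |w - y1| = 0 := by
    have hw' := hw
    rw [hFss] at hw'
    obtain ⟨j, z, hz, hzw⟩ := Set.mem_iUnion.1 hw'
    have h1 : |z - y1| ≤ |w - y1| := hwm hz
    have e : w - y1 = r j * (z - y1) := by
      simp only at hzw
      rw [← hzw]; linear_combination hfix j
    have h2 : |w - y1| = r j * |z - y1| := by rw [e, abs_mul, abs_of_pos (hr j).1]
    have := hr j
    nlinarith [abs_nonneg (w - y1), abs_nonneg (z - y1)]
  refine Set.eq_singleton_iff_nonempty_unique_mem.2 ⟨hFne, fun y hy => ?_⟩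
  have h1 : |y - y1| ≤ |w - y1| := hwm hy
  rw [hw0] at h1
  have := abs_eq_zero.1 (le_antisymm h1 (abs_nonneg _))
  linarith

/-- main theorem: let `F ⊆ [0,1]` be a self-similar set for the
similitudes `f_j(x) = r_j x + b_j`, not a singleton, and suppose
`log r_j / log r_ℓ` is irrational for some `j ≠ ℓ`. Then every self-similar
measure `μ` on `F` with positive weights is Rajchman: `μ̂(ξ) → 0` as `|ξ| → ∞`. -/
theorem stmt18 {A : Type*} [Fintype A] (r b p : A → ℝ)
    (hr : ∀ j, 0 < r j ∧ r j < 1) (hp : ∀ j, 0 < p j ∧ p j < 1)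
    (hpsum : ∑ j, p j = 1)
    (F : Set ℝ) (hF1 : F ⊆ Set.Icc 0 1) (hFc : IsCompact F) (hFne : F.Nonempty)
    (hFss : F = ⋃ j, (fun y => r j * y + b j) '' F)
    (hFns : ¬ ∃ y, F = {y})
    (hirr : ∃ j ℓ, j ≠ ℓ ∧ Irrational (Real.log (r j) / Real.log (r ℓ)))
    (μ : Measure ℝ) [IsProbabilityMeasure μ] (hμF : μ F = 1)
    (hss : μ = ∑ j, ENNReal.ofReal (p j) • Measure.map (fun y => r j * y + b j) μ) :
    Tendsto (fun ξ : ℝ => ∫ y, Complex.exp (-2 * Real.pi * Complex.I * ξ * y) ∂μ)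
      (cocompact ℝ) (𝓝 0) := by
  obtain ⟨j1, j2, -, hirr⟩ := hirr
  have hat := fs_noatom r b p hr hp hpsum F hFc hFne hFss hFns μ hss
  have hae : ∀ᵐ y ∂μ, y ∈ F := by
    rw [← prob_compl_eq_zero_iff hFc.measurableSet] at hμF
    exact hμF
  set φ : ℝ → ℂ := fun ξ => ∫ y, Complex.exp (Complex.I * (-(2 * Real.pi * ξ * y) : ℝ)) ∂μ with hφ
  have hφe : (fun ξ : ℝ => ∫ y, Complex.exp (-2 * Real.pi * Complex.I * ξ * y) ∂μ) = φ := by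
    ext ξ
    simp only [hφ]
    congr 1
    ext y
    congr 1
    push_cast
    ring
  rw [hφe]
  have hExpInt : ∀ (ν : Measure ℝ) [IsFiniteMeasure ν] (ξ : ℝ),
      Integrable (fun y : ℝ => Complex.exp (Complex.I * (-(2 * Real.pi * ξ * y) : ℝ))) ν := by
    intro ν _ ξ
    refine Integrable.of_bound (C := 1) ?_ (Eventually.of_forall fun y => (fs_norm _).le)
    apply Continuous.aestronglyMeasurable
    fun_prop
  have hφ1 : ∀ ξ, ‖φ ξ‖ ≤ 1 := by
    intro ξ
    have := norm_integral_le_of_norm_le_const (μ := μ) (C := 1)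
      (f := fun y : ℝ => Complex.exp (Complex.I * (-(2 * Real.pi * ξ * y) : ℝ)))
      (Eventually.of_forall fun y => (fs_norm _).le)
    rwa [probReal_univ, mul_one] at this
  have hφl : ∀ ξ η, ‖φ ξ - φ η‖ ≤ 2 * Real.pi * |ξ - η| := by
    intro ξ η
    simp only [hφ]
    rw [← integral_sub (hExpInt μ ξ) (hExpInt μ η)]
    have := norm_integral_le_of_norm_le_const (μ := μ) (C := 2 * Real.pi * |ξ - η|)
      (f := fun y : ℝ => Complex.exp (Complex.I * (-(2 * Real.pi * ξ * y) : ℝ)) -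
        Complex.exp (Complex.I * (-(2 * Real.pi * η * y) : ℝ))) (by
      filter_upwards [hae] with y hy
      have hy := hF1 hy
      have e : Complex.exp (Complex.I * (-(2 * Real.pi * ξ * y) : ℝ)) -
        Complex.exp (Complex.I * (-(2 * Real.pi * η * y) : ℝ)) =
        Complex.exp (Complex.I * (-(2 * Real.pi * η * y) : ℝ)) *
        (Complex.exp (Complex.I * (-(2 * Real.pi * (ξ - η) * y) : ℝ)) - 1) := by
        rw [mul_sub, ← Complex.exp_add, mul_one]
        congr 2
        push_cast; ring
      rw [e, norm_mul, fs_norm, one_mul]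
      refine (Real.norm_exp_I_mul_ofReal_sub_one_le).trans ?_
      rw [Real.norm_eq_abs, abs_neg, abs_mul, abs_mul, abs_of_pos (by positivity : 0 < 2 * Real.pi),
        abs_of_nonneg hy.1]
      exact mul_le_of_le_one_right (by positivity) hy.2)
    simpa using this
  have hφs : ∀ ξ, φ ξ = ∑ j, (p j : ℂ) * (Complex.exp (Complex.I * (-(2 * Real.pi * ξ * b j) : ℝ)) * φ (ξ * r j)) := by
    intro ξ
    simp only [hφ]
    conv_lhs => rw [hss]
    have hfin : ∀ j, IsFiniteMeasure (ENNReal.ofReal (p j) • Measure.map (fun y => r j * y + b j) μ) :=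
      fun j => Measure.smul_finite _ ENNReal.ofReal_ne_top
    rw [integral_finsetSum_measure (fun j _ => by
      have := hfin j
      exact hExpInt _ ξ)]
    refine Finset.sum_congr rfl fun j _ => ?_
    rw [integral_smul_measure, integral_map (by fun_prop)
      (Continuous.aestronglyMeasurable (by fun_prop)), ENNReal.toReal_ofReal (hp j).1.le,
      Complex.real_smul]
    congr 1
    rw [← integral_const_mul]
    refine integral_congr_ae (Eventually.of_forall fun y => ?_)
    simp only
    rw [← Complex.exp_add]
    congr 1
    push_cast; ring
  set u : ℝ → ℝ := fun t => ‖φ (Real.exp t)‖ ^ 2 with hu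
  set x : A → ℝ := fun j => - Real.log (r j) with hx
  have hx0 : ∀ j, 0 < x j := fun j => neg_pos.2 (Real.log_neg (hr j).1 (hr j).2)
  have hut : Tendsto u atTop (𝓝 0) := by
    apply ren_main x p hx0 (fun j => (hp j).1) (fun j => (hp j).2.le) hpsum j1 j2
    · simpa only [hx, neg_div_neg_eq] using hirr
    · intro t; positivity
    · intro t; exact pow_le_one₀ (norm_nonneg _) (hφ1 _)
    · intro t
      have e : ∀ j, Real.exp (t - x j) = Real.exp t * r j := by
        intro j
        rw [hx, sub_neg_eq_add, Real.exp_add, Real.exp_log (hr j).1]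
      have h1 : ‖φ (Real.exp t)‖ ≤ ∑ j, p j * ‖φ (Real.exp (t - x j))‖ := by
        rw [hφs]
        refine (norm_sum_le _ _).trans (Finset.sum_le_sum fun j _ => ?_)
        rw [norm_mul, norm_mul, fs_norm, one_mul, e, Complex.norm_real, Real.norm_eq_abs,
          abs_of_pos (hp j).1]
      have h2 := (convexOn_pow (𝕜 := ℝ) 2).map_sum_le (t := Finset.univ) (w := p)
        (p := fun j => ‖φ (Real.exp (t - x j))‖) (fun j _ => (hp j).1.le) hpsum
        (fun j _ => norm_nonneg _)
      simp only [smul_eq_mul] at h2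
      exact (pow_le_pow_left₀ (norm_nonneg _) h1 2).trans h2
    · intro T
      refine ⟨2 * (2 * Real.pi * Real.exp T), by positivity, fun s t hst ht => ?_⟩
      have hexp : Real.exp t - Real.exp s ≤ Real.exp T * (t - s) := by
        have h1 := Real.add_one_le_exp (s - t)
        have h2 : Real.exp s = Real.exp t * Real.exp (s - t) := by rw [← Real.exp_add]; congr 1; ring
        have h3 : Real.exp t ≤ Real.exp T := Real.exp_le_exp.2 ht
        have h4 : 0 < Real.exp t := Real.exp_pos t
        rw [h2]
        nlinarith
      have hmono : Real.exp s ≤ Real.exp t := Real.exp_le_exp.2 hst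
      have h1 := (abs_norm_sub_norm_le _ _).trans (hφl (Real.exp t) (Real.exp s))
      rw [abs_of_nonneg (sub_nonneg.2 hmono)] at h1
      simp only [hu]
      rw [sq_sub_sq, abs_mul]
      have h2 : |‖φ (Real.exp t)‖ + ‖φ (Real.exp s)‖| ≤ 2 := by
        rw [abs_of_nonneg (by positivity)]
        linarith [hφ1 (Real.exp t), hφ1 (Real.exp s)]
      have h3 : 2 * Real.pi * (Real.exp t - Real.exp s) ≤ 2 * Real.pi * (Real.exp T * (t - s)) :=
        mul_le_mul_of_nonneg_left hexp (by positivity)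
      calc _ ≤ 2 * (2 * Real.pi * (Real.exp T * (t - s))) :=
            mul_le_mul h2 (h1.trans h3) (abs_nonneg _) (by norm_num)
        _ = _ := by ring
    · intro c hc
      exact fs_avg μ hat c hc
  have hu2 : Tendsto (fun ξ => ‖φ ξ‖) atTop (𝓝 0) := by
    have h1 : Tendsto (fun ξ => Real.sqrt (u (Real.log ξ))) atTop (𝓝 (Real.sqrt 0)) :=
      (Real.continuous_sqrt.tendsto 0).comp (hut.comp Real.tendsto_log_atTop)
    rw [Real.sqrt_zero] at h1
    refine h1.congr' ?_
    filter_upwards [eventually_gt_atTop 0] with ξ hξ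
    simp only [hu]
    rw [Real.exp_log hξ, Real.sqrt_sq (norm_nonneg _)]
  have hsymm : ∀ ξ, ‖φ (-ξ)‖ = ‖φ ξ‖ := by
    intro ξ
    have : φ (-ξ) = (starRingEnd ℂ) (φ ξ) := by
      simp only [hφ]
      rw [← integral_conj]
      congr 1
      ext y
      rw [← Complex.exp_conj]
      congr 1
      rw [map_mul, Complex.conj_I, Complex.conj_ofReal]
      push_cast
      ring
    rw [this, Complex.norm_conj]
  rw [tendsto_zero_iff_norm_tendsto_zero, cocompact_eq_atBot_atTop, tendsto_sup]
  refine ⟨?_, hu2⟩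
  have := hu2.comp tendsto_neg_atBot_atTop
  exact this.congr fun ξ => hsymm ξ
end

section
/- Let F ⊆ [0,1] be a self-similar set for f_j(x) = r_j x + b_j with F not a singleton, and suppose log r_i / log r_j is diophantine for some i ≠ j. Then for every self-similar measure μ on F there exists β > 0 such that |μ̂(ξ)| = O(1/|log|ξ||^β) as |ξ| → ∞. -/
open MeasureTheory Filter Topology
namespace S19
open scoped FourierTransform ContDiff

/-- smooth compactly supported test functions -/
structure TF (χ : ℝ → ℂ) : Prop where
  smooth : ContDiff ℝ ∞ χ
  cpt : HasCompactSupport χ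

noncomputable def hh (χ : ℝ → ℂ) (lam : ℝ) (t : ℝ) : ℂ :=
  χ t * Complex.exp (-2 * Real.pi * Complex.I * lam * Real.exp t)

lemma TF.deriv {χ : ℝ → ℂ} (h : TF χ) : TF (deriv χ) :=
  ⟨((contDiff_infty_iff_deriv (𝕜 := ℝ)).1 h.smooth).2, h.cpt.deriv⟩

lemma TF.mul {χ ψ : ℝ → ℂ} (h : TF χ) (hψ : ContDiff ℝ ∞ ψ) : TF (fun t => ψ t * χ t) :=
  ⟨hψ.mul h.smooth, h.cpt.mul_left⟩

lemma smooth_osc (lam : ℝ) : ContDiff ℝ ∞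
    (fun t : ℝ => Complex.exp (-2 * Real.pi * Complex.I * lam * Real.exp t)) := by
  apply ContDiff.cexp
  apply ContDiff.mul contDiff_const
  exact Complex.ofRealCLM.contDiff.comp Real.contDiff_exp

lemma smooth_exp : ContDiff ℝ ∞ (fun t : ℝ => ((Real.exp t : ℝ) : ℂ)) :=
  Complex.ofRealCLM.contDiff.comp Real.contDiff_exp

lemma smooth_exp_neg : ContDiff ℝ ∞ (fun t : ℝ => ((Real.exp (-t) : ℝ) : ℂ)) :=
  Complex.ofRealCLM.contDiff.comp (Real.contDiff_exp.comp contDiff_neg)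

lemma smooth_id : ContDiff ℝ ∞ (fun t : ℝ => ((t : ℝ) : ℂ)) :=
  Complex.ofRealCLM.contDiff

lemma TF.hh {χ : ℝ → ℂ} (h : TF χ) (lam : ℝ) : TF (hh χ lam) :=
  ⟨h.smooth.mul (smooth_osc lam), h.cpt.mul_right⟩

lemma TF.integrable {χ : ℝ → ℂ} (h : TF χ) : Integrable χ :=
  h.smooth.continuous.integrable_of_hasCompactSupport h.cpt

lemma TF.differentiable {χ : ℝ → ℂ} (h : TF χ) : Differentiable ℝ χ :=
  h.smooth.differentiable (by simp)

lemma norm_osc (lam t : ℝ) :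
    ‖Complex.exp (-2 * Real.pi * Complex.I * lam * Real.exp t)‖ = 1 := by
  have : (-2 * Real.pi * Complex.I * lam * Real.exp t : ℂ)
    = ((-2 * Real.pi * lam * Real.exp t : ℝ) : ℂ) * Complex.I := by push_cast; ring
  rw [this, Complex.norm_exp_ofReal_mul_I]

lemma norm_hh (χ : ℝ → ℂ) (lam t : ℝ) : ‖hh χ lam t‖ = ‖χ t‖ := by
  rw [hh, norm_mul, norm_osc, mul_one]

lemma deriv_hh {χ : ℝ → ℂ} (h : TF χ) (lam : ℝ) :
    deriv (hh χ lam) = fun t => hh (deriv χ) lam t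
      + (-2 * Real.pi * Complex.I * lam) * hh (fun t => (Real.exp t : ℂ) * χ t) lam t := by
  ext t
  have h1 : HasDerivAt χ (deriv χ t) t := (h.differentiable t).hasDerivAt
  have h2 : HasDerivAt (fun t : ℝ => ((Real.exp t : ℝ) : ℂ)) ((Real.exp t : ℝ) : ℂ) t :=
    (Real.hasDerivAt_exp t).ofReal_comp
  have h3 := (h2.const_mul (-2 * Real.pi * Complex.I * lam : ℂ)).cexp
  have h4 := (h1.mul h3).deriv
  have : hh χ lam = χ * fun t : ℝ => Complex.exp (-2 * Real.pi * Complex.I * lam * Real.exp t) := rfl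
  rw [this, h4]
  simp only [hh]
  ring

/-- the basic integration by parts identity -/
lemma ibp {χ : ℝ → ℂ} (h : TF χ) (lam θ : ℝ) :
    (2 * Real.pi * Complex.I * θ) * 𝓕 (hh χ lam) θ = 𝓕 (hh (deriv χ) lam) θ
      + (-2 * Real.pi * Complex.I * lam) * 𝓕 (hh (fun t => (Real.exp t : ℂ) * χ t) lam) θ := by
  have h1 := congrFun (Real.fourier_deriv (h.hh lam).integrable (h.hh lam).differentiable
    (h.hh lam).deriv.integrable) θ
  rw [smul_eq_mul] at h1
  rw [← h1, deriv_hh h]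
  have i1 := (h.deriv.hh lam).integrable
  have i2 := ((h.mul smooth_exp).hh lam).integrable
  simp only [Real.fourier_real_eq_integral_exp_smul, smul_eq_mul]
  rw [← integral_const_mul, ← integral_add]
  · congr 1; ext v; ring
  · have := (Real.fourierIntegral_convergent_iff (μ := volume) (f := hh (_root_.deriv χ) lam) θ).2 i1
    refine this.congr (ae_of_all _ fun v => ?_)
    simp [Circle.smul_def, Real.fourierChar_apply]
    left; congr 1; ring
  · have := (Real.fourierIntegral_convergent_iff (μ := volume) (f := hh (fun t => (Real.exp t : ℂ) * χ t) lam) θ).2 i2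
    refine (this.const_mul (-2 * Real.pi * Complex.I * lam)).congr (ae_of_all _ fun v => ?_)
    simp [Circle.smul_def, Real.fourierChar_apply]
    left; left; congr 1; ring

lemma fourier_bd {χ : ℝ → ℂ} (lam θ : ℝ) : ‖𝓕 (hh χ lam) θ‖ ≤ ∫ t, ‖χ t‖ := by
  rw [Real.fourier_real_eq_integral_exp_smul]
  refine (norm_integral_le_integral_norm _).trans (le_of_eq ?_)
  congr 1; ext v
  rw [norm_smul, norm_hh, Complex.norm_exp_ofReal_mul_I, one_mul]

lemma L1 (K : ℕ) : ∀ χ : ℝ → ℂ, TF χ → ∃ C > 0, ∀ lam θ : ℝ,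
    (1 + |θ|) ^ K * ‖𝓕 (hh χ lam) θ‖ ≤ C * (1 + |lam|) ^ K := by
  induction K with
  | zero =>
    intro χ h
    refine ⟨(∫ t, ‖χ t‖) + 1, by positivity, fun lam θ => ?_⟩
    have := fourier_bd (χ := χ) lam θ
    simp; linarith
  | succ K ih =>
    intro χ h
    obtain ⟨C0, h0, H0⟩ := ih χ h
    obtain ⟨C1, h1, H1⟩ := ih _ h.deriv
    obtain ⟨C2, h2, H2⟩ := ih _ (h.mul smooth_exp)
    refine ⟨C0 + C1 + 2 * Real.pi * C2, by positivity, fun lam θ => ?_⟩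
    have e := congrArg norm (ibp h lam θ)
    have e2 : 2 * Real.pi * |θ| * ‖𝓕 (hh χ lam) θ‖ ≤ ‖𝓕 (hh (deriv χ) lam) θ‖ + 2 * Real.pi * |lam| *
      ‖𝓕 (hh (fun t => (Real.exp t : ℂ) * χ t) lam) θ‖ := by
      have := norm_add_le (𝓕 (hh (deriv χ) lam) θ) ((-2 * Real.pi * Complex.I * lam) * 𝓕 (hh (fun t => (Real.exp t : ℂ) * χ t) lam) θ)
      rw [← e] at this
      simpa [abs_of_pos Real.pi_pos, mul_assoc] using this
    specialize H0 lam θ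
    specialize H1 lam θ
    specialize H2 lam θ
    have hpi := Real.pi_gt_three
    set x := ‖𝓕 (hh χ lam) θ‖
    set y := ‖𝓕 (hh (deriv χ) lam) θ‖
    set z := ‖𝓕 (hh (fun t => (Real.exp t : ℂ) * χ t) lam) θ‖
    have hx : 0 ≤ x := norm_nonneg _
    have hθ := abs_nonneg θ
    have hl := abs_nonneg lam
    have hP : 0 ≤ (1 + |θ|) ^ K := by positivity
    have hQ : 0 ≤ (1 + |lam|) ^ K := by positivity
    have e3 : |θ| * x ≤ y + 2 * Real.pi * |lam| * z := by
      have : 0 ≤ |θ| * x := by positivity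
      nlinarith
    calc (1 + |θ|) ^ (K+1) * x = (1 + |θ|) ^ K * x + (1 + |θ|) ^ K * (|θ| * x) := by ring
      _ ≤ (1 + |θ|) ^ K * x + (1 + |θ|) ^ K * (y + 2 * Real.pi * |lam| * z) := by gcongr
      _ = (1 + |θ|) ^ K * x + (1 + |θ|) ^ K * y + 2 * Real.pi * |lam| * ((1 + |θ|) ^ K * z) := by ring
      _ ≤ C0 * (1 + |lam|) ^ K + C1 * (1 + |lam|) ^ K + 2 * Real.pi * |lam| * (C2 * (1 + |lam|) ^ K) := by gcongr
      _ ≤ (C0 + C1 + 2 * Real.pi * C2) * (1 + |lam|) ^ (K+1) := by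
        have a1 : 0 ≤ (C0 + C1) * |lam| * (1 + |lam|) ^ K := by positivity
        have a2 : 0 ≤ 2 * Real.pi * C2 * (1 + |lam|) ^ K := by positivity
        rw [pow_succ]; nlinarith

lemma L2 (χ : ℝ → ℂ) (h : TF χ) : ∃ C > 0, ∀ lam θ : ℝ,
    (1 + |lam|) * ‖𝓕 (hh χ lam) θ‖ ≤ C * (1 + |θ|) := by
  have hφ := h.mul smooth_exp_neg
  set ψ : ℝ → ℂ := fun t => ((Real.exp (-t) : ℝ) : ℂ) * χ t with hψ
  have hψe : (fun t => (Real.exp t : ℂ) * ψ t) = χ := by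
    ext t
    simp only [hψ]
    rw [← mul_assoc, ← Complex.ofReal_mul, ← Real.exp_add]; simp
  refine ⟨(∫ t, ‖χ t‖) + (∫ t, ‖deriv ψ t‖) + 2 * Real.pi * (∫ t, ‖ψ t‖) + 1, by positivity, fun lam θ => ?_⟩
  have e := ibp hφ lam θ
  rw [hψe] at e
  have e' : (2 * Real.pi * Complex.I * lam) * 𝓕 (hh χ lam) θ = 𝓕 (hh (deriv ψ) lam) θ -
    (2 * Real.pi * Complex.I * θ) * 𝓕 (hh ψ lam) θ := by rw [e]; ring
  have e1 : 2 * Real.pi * |lam| * ‖𝓕 (hh χ lam) θ‖ ≤ ‖𝓕 (hh (deriv ψ) lam) θ‖ + 2 * Real.pi * |θ| *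
      ‖𝓕 (hh ψ lam) θ‖ := by
    have := norm_sub_le (𝓕 (hh (deriv ψ) lam) θ) ((2 * Real.pi * Complex.I * θ) * 𝓕 (hh ψ lam) θ)
    rw [← e'] at this
    simpa [abs_of_pos Real.pi_pos, mul_assoc] using this
  have b1 := fourier_bd (χ := χ) lam θ
  have b2 := fourier_bd (χ := deriv ψ) lam θ
  have b3 := fourier_bd (χ := ψ) lam θ
  have hpi := Real.pi_gt_three
  have hθ := abs_nonneg θ
  have hl := abs_nonneg lam
  have c1 : 0 ≤ ∫ t, ‖χ t‖ := by positivity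
  have c2 : 0 ≤ ∫ t, ‖deriv ψ t‖ := by positivity
  have c3 : 0 ≤ ∫ t, ‖ψ t‖ := by positivity
  generalize (∫ t, ‖χ t‖) = I1 at *
  generalize (∫ t, ‖deriv ψ t‖) = I2 at *
  generalize (∫ t, ‖ψ t‖) = I3 at *
  have d0 : 0 ≤ ‖𝓕 (hh χ lam) θ‖ := norm_nonneg _
  generalize ‖𝓕 (hh χ lam) θ‖ = x at *
  generalize ‖𝓕 (hh (deriv ψ) lam) θ‖ = y at *
  generalize ‖𝓕 (hh ψ lam) θ‖ = z at *
  have e3 : |lam| * x ≤ y + 2 * Real.pi * |θ| * z := by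
    have : 0 ≤ |lam| * x := by positivity
    nlinarith
  have e4 : 2 * Real.pi * |θ| * z ≤ 2 * Real.pi * |θ| * I3 := by gcongr
  have e5 : 0 ≤ |θ| * (I1 + I2 + 1) := by positivity
  have e6 : 0 ≤ 2 * Real.pi * I3 := by positivity
  nlinarith

lemma L3 (χ : ℝ → ℂ) (h : TF χ) : ∃ C > 0, ∀ lam θ : ℝ, |θ| ≤ 1 →
    (1 + |lam|) * ‖𝓕 (hh χ lam) θ - 𝓕 (hh χ lam) 0‖ ≤ C * |θ| := by
  have hψ := h.mul (ψ := fun t => -(2 * Real.pi * Complex.I) * t) (contDiff_const.mul smooth_id)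
  obtain ⟨C, hC, H⟩ := L2 _ hψ
  refine ⟨2 * C, by positivity, fun lam θ hθ => ?_⟩
  have hd : ∀ w, HasDerivAt (𝓕 (hh χ lam)) (𝓕 (hh (fun t => -(2 * Real.pi * Complex.I) * t * χ t) lam) w) w := by
    intro w
    have i2 : Integrable (fun x : ℝ => x • hh χ lam x) := by
      refine (((h.mul smooth_id).hh lam).integrable).congr (ae_of_all _ fun v => ?_)
      simp [hh]; ring
    have := Real.hasDerivAt_fourier (h.hh lam).integrable i2 w
    have e : (fun x : ℝ => (-2 * (Real.pi : ℂ) * Complex.I * x) • hh χ lam x)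
        = hh (fun t => -(2 * Real.pi * Complex.I) * t * χ t) lam := by
      ext x; simp only [hh, smul_eq_mul]; ring
    rw [e] at this
    exact this
  have hl := abs_nonneg lam
  have := Convex.norm_image_sub_le_of_norm_hasDerivWithin_le (s := Set.Icc (-1) 1) (x := 0) (y := θ) (C := 2 * C / (1 + |lam|))
    (fun w _ => (hd w).hasDerivWithinAt) (fun w hw => by
      rw [le_div_iff₀ (by positivity), mul_comm]
      refine (H lam w).trans ?_
      have : |w| ≤ 1 := abs_le.2 hw
      nlinarith) (convex_Icc _ _) (by simp) (abs_le.1 hθ)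
  rw [sub_zero, Real.norm_eq_abs, div_mul_eq_mul_div, le_div_iff₀ (by positivity)] at this
  linarith

lemma integrable_four {χ : ℝ → ℂ} (h : TF χ) (lam : ℝ) : Integrable (𝓕 (hh χ lam)) := by
  obtain ⟨C, hC, H⟩ := L1 2 χ h
  have hcont : Continuous (𝓕 (hh χ lam)) := by
    have i2 : Integrable (fun x : ℝ => x • hh χ lam x) := by
      refine (((h.mul smooth_id).hh lam).integrable).congr (ae_of_all _ fun v => ?_)
      simp [hh]; ring
    rw [continuous_iff_continuousAt]
    exact fun w => (Real.hasDerivAt_fourier (h.hh lam).integrable i2 w).continuousAt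
  refine (integrable_inv_one_add_sq.const_mul (C * (1 + |lam|) ^ 2)).mono' hcont.aestronglyMeasurable (ae_of_all _ fun θ => ?_)
  have := H lam θ
  rw [← div_eq_mul_inv, le_div_iff₀ (by positivity)]
  refine le_trans ?_ this
  rw [mul_comm]
  gcongr
  have := abs_nonneg θ
  nlinarith [sq_abs θ]

lemma inversion {χ : ℝ → ℂ} (h : TF χ) (lam t : ℝ) :
    hh χ lam t = ∫ θ, 𝓕 (hh χ lam) θ * Complex.exp (2 * Real.pi * Complex.I * θ * t) := by
  have := congrFun ((h.hh lam).smooth.continuous.fourierInv_fourier_eq (h.hh lam).integrable (integrable_four h lam)) t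
  rw [← this, Real.fourierInv_eq']
  congr 1; ext v
  simp
  rw [mul_comm]; congr 2; ring
end S19

namespace S19
open scoped FourierTransform ContDiff

section ops
variable {A : Type*} [Fintype A] {E : Type*} [NormedAddCommGroup E] [NormedSpace ℝ E]

noncomputable def Pop (p X : A → ℝ) (u : ℝ → E) (t : ℝ) : E := ∑ k, p k • u (t - X k)

noncomputable def Lz (p X : A → ℝ) (u : ℝ → E) (t : ℝ) : E := (1 / 2 : ℝ) • (u t + Pop p X u t)

noncomputable def WN (p X : A → ℝ) : ℕ → (ℝ → E) → ℝ → E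
  | 0, _ => fun _ => 0
  | N + 1, f => fun t => f t + Pop p X (WN p X N f) t

noncomputable def LzN (p X : A → ℝ) : ℕ → (ℝ → E) → ℝ → E
  | 0, u => u
  | n + 1, u => Lz p X (LzN p X n u)

noncomputable def TT (p X : A → ℝ) (n N : ℕ) (f : ℝ → E) : ℝ → E := LzN p X n (WN p X N f)

variable (p X : A → ℝ)

lemma Pop_lin (u v : ℝ → ℂ) (c : ℂ) :
    Pop p X (fun t => u t + c * v t) = fun t => Pop p X u t + c * Pop p X v t := by
  ext t
  simp only [Pop, smul_add, Finset.sum_add_distrib, Finset.mul_sum]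
  congr 1
  exact Finset.sum_congr rfl fun k _ => by simp; ring

lemma Lz_lin (u v : ℝ → ℂ) (c : ℂ) :
    Lz p X (fun t => u t + c * v t) = fun t => Lz p X u t + c * Lz p X v t := by
  ext t
  simp only [Lz, Pop_lin, Complex.real_smul]
  ring

lemma WN_lin (N : ℕ) (u v : ℝ → ℂ) (c : ℂ) :
    WN p X N (fun t => u t + c * v t) = fun t => WN p X N u t + c * WN p X N v t := by
  induction N with
  | zero => ext t; simp [WN]
  | succ N ih =>
    ext t
    simp only [WN, ih, Pop_lin]
    ring

lemma TT_lin (n N : ℕ) (u v : ℝ → ℂ) (c : ℂ) :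
    TT p X n N (fun t => u t + c * v t) = fun t => TT p X n N u t + c * TT p X n N v t := by
  induction n with
  | zero => simp only [TT, LzN, WN_lin]
  | succ n ih =>
    simp only [TT, LzN] at ih ⊢
    rw [ih, Lz_lin]

lemma Pop_ofReal (u : ℝ → ℝ) : Pop p X (fun t => (u t : ℂ)) = fun t => ((Pop p X u t : ℝ) : ℂ) := by
  ext t; simp [Pop]

lemma TT_ofReal (n N : ℕ) (u : ℝ → ℝ) :
    TT p X n N (fun t => (u t : ℂ)) = fun t => ((TT p X n N u t : ℝ) : ℂ) := by
  induction n with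
  | zero =>
    simp only [TT, LzN]
    induction N with
    | zero => ext t; simp [WN]
    | succ N ih => ext t; simp only [WN, ih, Pop_ofReal]; push_cast; rfl
  | succ n ih =>
    simp only [TT, LzN] at ih ⊢
    rw [ih]; ext t
    simp only [Lz, Pop_ofReal, Complex.real_smul, smul_eq_mul]; push_cast; ring

/-- `U` is the superposition of the family `u`. -/
def Rel {Z : Type*} [MeasurableSpace Z] (ν : Measure Z) (U : ℝ → ℂ) (u : Z → ℝ → ℂ) : Prop :=
  ∀ t, Integrable (fun z => u z t) ν ∧ U t = ∫ z, u z t ∂ν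

section rel
variable {Z : Type*} [MeasurableSpace Z] {ν : Measure Z} {U V : ℝ → ℂ} {u v : Z → ℝ → ℂ}
variable {p X}

lemma Rel.pop (h : Rel ν U u) : Rel ν (Pop p X U) (fun z => Pop p X (u z)) := by
  intro t
  simp only [Pop]
  have hi : ∀ k ∈ (Finset.univ : Finset A), Integrable (fun z => p k • u z (t - X k)) ν :=
    fun k _ => ((h _).1.smul (p k))
  refine ⟨integrable_finsetSum _ hi, ?_⟩
  rw [integral_finsetSum _ hi]
  refine Finset.sum_congr rfl fun k _ => ?_
  rw [integral_smul, (h _).2]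

lemma Rel.add (h : Rel ν U u) (h' : Rel ν V v) :
    Rel ν (fun t => U t + V t) (fun z t => u z t + v z t) := by
  intro t
  refine ⟨(h t).1.add (h' t).1, ?_⟩
  show U t + V t = _
  rw [integral_add (h t).1 (h' t).1, (h t).2, (h' t).2]

lemma Rel.lz (h : Rel ν U u) : Rel ν (Lz p X U) (fun z => Lz p X (u z)) := by
  intro t
  have := (h.add (h.pop (p := p) (X := X))) t
  refine ⟨this.1.smul (1/2:ℝ), ?_⟩
  simp only [Lz]
  rw [integral_smul]
  exact congrArg _ this.2

lemma Rel.wn (h : Rel ν U u) (N : ℕ) : Rel ν (WN p X N U) (fun z => WN p X N (u z)) := by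
  induction N with
  | zero => intro t; simp [WN]
  | succ N ih => exact h.add ih.pop

lemma Rel.tt (h : Rel ν U u) (n N : ℕ) : Rel ν (TT p X n N U) (fun z => TT p X n N (u z)) := by
  induction n with
  | zero => exact h.wn N
  | succ n ih => exact ih.lz
end rel

noncomputable def phi (θ : ℝ) : ℂ := ∑ k, (p k : ℂ) * Complex.exp (-(2 * Real.pi * Complex.I * θ * X k))

noncomputable def ee (θ t : ℝ) : ℂ := Complex.exp (2 * Real.pi * Complex.I * θ * t)

noncomputable def mult (n N : ℕ) (θ : ℝ) : ℂ :=
  ((1 + phi p X θ) / 2) ^ n * ∑ m ∈ Finset.range N, phi p X θ ^ m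

lemma Pop_ee (θ : ℝ) (c : ℂ) : Pop p X (fun t => c * ee θ t) = fun t => (c * phi p X θ) * ee θ t := by
  ext t
  simp only [Pop, phi, Finset.mul_sum, Finset.sum_mul]
  refine Finset.sum_congr rfl fun k _ => ?_
  simp only [ee, Complex.real_smul]
  have : (2 * Real.pi * Complex.I * θ * ((t - X k : ℝ) : ℂ)) = -(2 * Real.pi * Complex.I * θ * X k) + 2 * Real.pi * Complex.I * θ * t := by
    push_cast; ring
  rw [this, Complex.exp_add]
  ring

lemma TT_ee (n N : ℕ) (θ : ℝ) (c : ℂ) :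
    TT p X n N (fun t => c * ee θ t) = fun t => (c * mult p X n N θ) * ee θ t := by
  induction n with
  | zero =>
    simp only [TT, LzN, mult, pow_zero, one_mul]
    induction N with
    | zero => ext t; simp [WN]
    | succ N ih =>
      ext t
      simp only [WN, ih, Pop_ee]
      rw [geom_sum_succ]
      ring
  | succ n ih =>
    simp only [TT, LzN] at ih ⊢
    rw [ih]; ext t
    simp only [Lz, Pop_ee]
    simp only [mult, pow_succ, Complex.real_smul]
    push_cast
    ring

lemma norm_ee (θ t : ℝ) : ‖ee θ t‖ = 1 := by
  have : (2 * Real.pi * Complex.I * θ * t : ℂ) = ((2 * Real.pi * θ * t : ℝ) : ℂ) * Complex.I := by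
    push_cast; ring
  rw [ee, this, Complex.norm_exp_ofReal_mul_I]

variable {p X}

lemma norm_phi (hp : ∀ k, 0 < p k) (hs : ∑ k, p k = 1) (θ : ℝ) : ‖phi p X θ‖ ≤ 1 := by
  rw [← hs]
  refine norm_sum_le_of_le _ fun k _ => ?_
  have : (-(2 * Real.pi * Complex.I * θ * X k) : ℂ) = ((-(2 * Real.pi * θ * X k) : ℝ) : ℂ) * Complex.I := by
    push_cast; ring
  rw [norm_mul, this, Complex.norm_exp_ofReal_mul_I, mul_one, Complex.norm_real, Real.norm_eq_abs, abs_of_pos (hp k)]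

lemma norm_half (hp : ∀ k, 0 < p k) (hs : ∑ k, p k = 1) (θ : ℝ) : ‖(1 + phi p X θ) / 2‖ ≤ 1 - (1 - (phi p X θ).re) / 4 := by
  have h1 := norm_phi (X := X) hp hs θ
  have h2 := Complex.abs_re_le_norm (phi p X θ)
  have h3 : (phi p X θ).re ≤ 1 := (le_abs_self _).trans (h2.trans h1)
  have h4 : -1 ≤ (phi p X θ).re := by have := (abs_le.1 (h2.trans h1)).1; exact this
  apply le_of_sq_le_sq _ (by linarith)
  have h5 : ‖phi p X θ‖ ^ 2 ≤ 1 := pow_le_one₀ (norm_nonneg _) h1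
  rw [Complex.sq_norm, Complex.normSq_apply] at h5 ⊢
  simp
  nlinarith [sq_nonneg (1 - (phi p X θ).re)]

lemma geom_bd (hp : ∀ k, 0 < p k) (hs : ∑ k, p k = 1) (N : ℕ) (θ : ℝ) :
    ‖1 - phi p X θ‖ * ‖∑ m ∈ Finset.range N, phi p X θ ^ m‖ ≤ 2 := by
  rw [← norm_mul, mul_neg_geom_sum]
  refine (norm_sub_le _ _).trans ?_
  rw [norm_one, norm_pow]
  have := pow_le_one₀ (n := N) (norm_nonneg _) (norm_phi (X := X) hp hs θ)
  linarith

lemma half_le_one (hp : ∀ k, 0 < p k) (hs : ∑ k, p k = 1) (θ : ℝ) : ‖(1 + phi p X θ) / 2‖ ≤ 1 := by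
  have h1 := norm_phi (X := X) hp hs θ
  have := norm_add_le 1 (phi p X θ)
  rw [norm_div]; simp at this ⊢; linarith

lemma mult_small (hp : ∀ k, 0 < p k) (hs : ∑ k, p k = 1) (n N : ℕ) (θ c : ℝ) (hc : 0 < c) (h : c ≤ ‖1 - phi p X θ‖) :
    ‖mult p X n N θ‖ ≤ 2 / c := by
  have h1 := geom_bd (X := X) hp hs N θ
  have h2 := half_le_one (X := X) hp hs θ
  rw [mult, norm_mul, norm_pow, le_div_iff₀ hc]
  have h3 := pow_le_one₀ (n := n) (norm_nonneg _) h2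
  have h4 := norm_nonneg (∑ m ∈ Finset.range N, phi p X θ ^ m)
  calc _ ≤ 1 * ‖∑ m ∈ Finset.range N, phi p X θ ^ m‖ * ‖1 - phi p X θ‖ := by gcongr
    _ ≤ 2 := by rw [one_mul, mul_comm]; exact h1

lemma mult_large (hp : ∀ k, 0 < p k) (hs : ∑ k, p k = 1) (n N : ℕ) (hn : 1 ≤ n) (θ d : ℝ) (hd : 0 < d) (h : d ≤ 1 - (phi p X θ).re) :
    ‖mult p X n N θ‖ ≤ 8 / (n * d ^ 2) := by
  have h1 := geom_bd (X := X) hp hs N θ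
  have h2 := norm_half (X := X) hp hs θ
  have h2' : ‖(1 + phi p X θ) / 2‖ ≤ 1 - d / 4 := by linarith
  have h0 : 0 ≤ 1 - d / 4 := (norm_nonneg _).trans h2'
  have h3 : ‖(1 + phi p X θ) / 2‖ ^ n ≤ (1 - d / 4) ^ n := by gcongr
  have hn' : (1:ℝ) ≤ n := by exact_mod_cast hn
  have h4 : (1 - d / 4) ^ n * (n * d) ≤ 4 := by
    have a := one_add_mul_le_pow (a := d / 4) (by linarith) n
    have b : (1 - d / 4) ^ n * (1 + d / 4) ^ n ≤ 1 := by
      rw [← mul_pow]; apply pow_le_one₀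
      · apply mul_nonneg h0; linarith
      · nlinarith
    have c := mul_le_mul_of_nonneg_left a (pow_nonneg h0 n)
    have := pow_nonneg h0 n
    nlinarith
  have h5 : d ≤ ‖1 - phi p X θ‖ := by
    refine h.trans (le_trans (le_of_eq (by simp)) (Complex.re_le_norm _))
  have h6 := norm_nonneg (∑ m ∈ Finset.range N, phi p X θ ^ m)
  rw [mult, norm_mul, norm_pow, le_div_iff₀ (by positivity)]
  calc _ ≤ (1 - d / 4) ^ n * ‖∑ m ∈ Finset.range N, phi p X θ ^ m‖ * (n * d ^ 2) := by gcongr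
    _ = ((1 - d / 4) ^ n * (n * d)) * (d * ‖∑ m ∈ Finset.range N, phi p X θ ^ m‖) := by ring
    _ ≤ 4 * (‖1 - phi p X θ‖ * ‖∑ m ∈ Finset.range N, phi p X θ ^ m‖) := by
      gcongr
    _ ≤ 8 := by linarith

lemma LzN_bd (hp : ∀ k, 0 < p k) (hs : ∑ k, p k = 1) (n : ℕ) (u : ℝ → ℂ) (B : ℝ) (h : ∀ t, ‖u t‖ ≤ B) (t : ℝ) : ‖LzN p X n u t‖ ≤ B := by
  induction n generalizing t with
  | zero => exact h t
  | succ n ih =>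
    have : ‖Pop p X (LzN p X n u) t‖ ≤ B := by
      calc _ ≤ ∑ k, p k * B := norm_sum_le_of_le _ fun k _ => by
            rw [norm_smul, Real.norm_eq_abs, abs_of_pos (hp k)]
            exact mul_le_mul_of_nonneg_left (ih _) (hp k).le
        _ = B := by rw [← Finset.sum_mul, hs, one_mul]
    simp only [LzN, Lz]
    rw [norm_smul]
    have h2 := norm_add_le (LzN p X n u t) (Pop p X (LzN p X n u) t)
    have h3 := ih t
    rw [Real.norm_eq_abs, abs_of_pos (by norm_num)]; linarith

lemma WN_bd (hp : ∀ k, 0 < p k) (hs : ∑ k, p k = 1) (x0 : ℝ) (hx0 : 0 < x0) (hX : ∀ k, x0 ≤ X k) (R B : ℝ) (hR : 0 < R) (u : ℝ → ℂ) (h : ∀ t, ‖u t‖ ≤ B)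
    (h' : ∀ t, R < |t| → u t = 0) (N : ℕ) (t : ℝ) :
    ‖WN p X N u t‖ ≤ B * max 0 (min ((t + R) / x0 + 1) (2 * R / x0 + 1)) := by
  have hB : 0 ≤ B := (norm_nonneg _).trans (h 0)
  induction N generalizing t with
  | zero => simp only [WN, norm_zero]; positivity
  | succ N ih =>
    simp only [WN]
    set ψ : ℝ → ℝ := fun t => max 0 (min ((t + R) / x0 + 1) (2 * R / x0 + 1)) with hψ
    have mono : Monotone ψ := by
      intro a b hab; simp only [hψ]; gcongr
    have h1 : ‖Pop p X (WN p X N u) t‖ ≤ B * ψ (t - x0) := by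
      calc _ ≤ ∑ k, p k * (B * ψ (t - x0)) := norm_sum_le_of_le _ fun k _ => by
            rw [norm_smul, Real.norm_eq_abs, abs_of_pos (hp k)]
            refine mul_le_mul_of_nonneg_left ((ih _).trans ?_) (hp k).le
            exact mul_le_mul_of_nonneg_left (mono (by linarith [hX k])) hB
        _ = _ := by rw [← Finset.sum_mul, hs, one_mul]
    refine (norm_add_le _ _).trans ?_
    by_cases ht : R < |t|
    · rw [h' t ht, norm_zero, zero_add]
      exact h1.trans (mul_le_mul_of_nonneg_left (mono (by linarith)) hB)
    · have ht' := abs_le.1 (not_lt.1 ht)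
      have e1 : ψ t = (t + R) / x0 + 1 := by
        simp only [hψ]
        rw [min_eq_left, max_eq_right]
        · have : 0 ≤ (t + R) / x0 := div_nonneg (by linarith) hx0.le
          linarith
        · gcongr; linarith
      have e2 : ψ (t - x0) ≤ (t + R) / x0 := by
        simp only [hψ]
        apply max_le (div_nonneg (by linarith) hx0.le)
        refine (min_le_left _ _).trans (le_of_eq ?_)
        field_simp; ring
      have e3 : ψ (t - x0) ≤ ψ t - 1 := by linarith
      have e4 : ‖u t‖ ≤ B := h t
      have := mul_le_mul_of_nonneg_left e3 hB
      show _ ≤ B * ψ t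
      linarith

lemma TT_bd (hp : ∀ k, 0 < p k) (hs : ∑ k, p k = 1) (x0 : ℝ) (hx0 : 0 < x0) (hX : ∀ k, x0 ≤ X k) (R B : ℝ) (hR : 0 < R) (u : ℝ → ℂ) (h : ∀ t, ‖u t‖ ≤ B)
    (h' : ∀ t, R < |t| → u t = 0) (n N : ℕ) (t : ℝ) :
    ‖TT p X n N u t‖ ≤ B * (2 * R / x0 + 1) := by
  have hB : 0 ≤ B := (norm_nonneg _).trans (h 0)
  apply LzN_bd hp hs
  intro t
  refine (WN_bd hp hs x0 hx0 hX R B hR u h h' N t).trans (mul_le_mul_of_nonneg_left ?_ hB)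
  exact max_le (by positivity) (min_le_right _ _)

end ops
end S19

namespace S19
open scoped FourierTransform ContDiff
section phi
variable {A : Type*} [Fintype A] {p X : A → ℝ}

lemma phi_re (θ : ℝ) : (phi p X θ).re = ∑ k, p k * Real.cos (2 * Real.pi * (θ * X k)) := by
  rw [phi, Complex.re_sum]
  refine Finset.sum_congr rfl fun k _ => ?_
  have : (-(2 * Real.pi * Complex.I * θ * X k) : ℂ) = ((-(2 * Real.pi * (θ * X k)) : ℝ) : ℂ) * Complex.I := by
    push_cast; ring
  rw [Complex.re_ofReal_mul, this, Complex.exp_ofReal_mul_I_re, Real.cos_neg]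

lemma phi_im (θ : ℝ) : (phi p X θ).im = -∑ k, p k * Real.sin (2 * Real.pi * (θ * X k)) := by
  rw [phi, Complex.im_sum, ← Finset.sum_neg_distrib]
  refine Finset.sum_congr rfl fun k _ => ?_
  have : (-(2 * Real.pi * Complex.I * θ * X k) : ℂ) = ((-(2 * Real.pi * (θ * X k)) : ℝ) : ℂ) * Complex.I := by
    push_cast; ring
  rw [Complex.im_ofReal_mul, this, Complex.exp_ofReal_mul_I_im, Real.sin_neg]; ring


lemma phi_small (hp : ∀ k, 0 < p k) (hs : ∑ k, p k = 1) (x0 D : ℝ) (hx0 : 0 < x0) (hX : ∀ k, x0 ≤ X k) (hD : ∀ k, X k ≤ D) (hD0 : 0 < D)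
    (θ : ℝ) (hθ : |θ| ≤ 1 / (4 * D)) : 4 * x0 * |θ| ≤ ‖1 - phi p X θ‖ := by
  have key : ∀ s : ℝ, 0 ≤ s → s ≤ 1 / (4 * D) → 4 * x0 * s ≤ ∑ k, p k * Real.sin (2 * Real.pi * (s * X k)) := by
    intro s hs0 hs1
    calc 4 * x0 * s = ∑ k, p k * (4 * x0 * s) := by rw [← Finset.sum_mul, hs, one_mul]
      _ ≤ _ := by
        refine Finset.sum_le_sum fun k _ => mul_le_mul_of_nonneg_left ?_ (hp k).le
        have hXk : 0 < X k := hx0.trans_le (hX k)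
        have hsX : s * X k ≤ 1 / 4 := by
          calc s * X k ≤ 1 / (4 * D) * D := by gcongr; exact hD k
            _ = 1 / 4 := by field_simp
        have hpi := Real.pi_pos
        have := Real.mul_le_sin (x := 2 * Real.pi * (s * X k)) (by positivity) (by nlinarith)
        refine le_trans ?_ this
        have e : 2 / Real.pi * (2 * Real.pi * (s * X k)) = 4 * X k * s := by field_simp; ring
        rw [e]; gcongr; exact hX k
  have him : |∑ k, p k * Real.sin (2 * Real.pi * (θ * X k))| ≤ ‖1 - phi p X θ‖ := by
    have := Complex.abs_im_le_norm (1 - phi p X θ)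
    rw [Complex.sub_im, phi_im] at this
    simpa using this
  refine le_trans ?_ him
  rcases le_total 0 θ with h | h
  · rw [abs_of_nonneg h] at hθ ⊢
    exact (key θ h hθ).trans (le_abs_self _)
  · rw [abs_of_nonpos h] at hθ ⊢
    refine (key (-θ) (by linarith) hθ).trans (le_trans (le_of_eq ?_) (neg_le_abs _))
    rw [← Finset.sum_neg_distrib]
    refine Finset.sum_congr rfl fun k _ => ?_
    rw [neg_mul, mul_neg, Real.sin_neg]; ring

lemma phi_re_bd (hp : ∀ k, 0 < p k) (hs : ∑ k, p k = 1) (θ : ℝ) (k : A) :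
    8 * p k * (θ * X k - round (θ * X k)) ^ 2 ≤ 1 - (phi p X θ).re := by
  have h1 : 1 - (phi p X θ).re = ∑ k, p k * (1 - Real.cos (2 * Real.pi * (θ * X k))) := by
    rw [phi_re]; simp only [mul_sub, Finset.sum_sub_distrib, mul_one, hs]
  rw [h1]
  refine le_trans ?_ (Finset.single_le_sum (f := fun k => p k * (1 - Real.cos (2 * Real.pi * (θ * X k))))
    (fun k _ => mul_nonneg (hp k).le (by linarith [Real.cos_le_one (2 * Real.pi * (θ * X k))])) (Finset.mem_univ k))
  set y := θ * X k
  have e : Real.cos (2 * Real.pi * y) = Real.cos (2 * Real.pi * (y - round y)) := by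
    rw [← Real.cos_sub_int_mul_two_pi _ (round y)]; congr 1; ring
  have hab := abs_sub_round y
  have hpi := Real.pi_pos
  have := Real.cos_le_one_sub_mul_cos_sq (x := 2 * Real.pi * (y - round y)) (by
    rw [abs_mul, abs_of_pos (by positivity)]; nlinarith)
  have e2 : 2 / Real.pi ^ 2 * (2 * Real.pi * (y - round y)) ^ 2 = 8 * (y - round y) ^ 2 := by
    field_simp; ring
  show _ ≤ p k * (1 - Real.cos (2 * Real.pi * y))
  rw [e, mul_comm 8, mul_assoc]
  refine mul_le_mul_of_nonneg_left ?_ (hp k).le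
  linarith

lemma phi_large (hp : ∀ k, 0 < p k) (hs : ∑ k, p k = 1) (hX : ∀ k, 0 < X k) (θ0 : ℝ) (hθ0 : 0 < θ0) (i j : A) (c l : ℝ) (hc : 0 < c)
    (hdio : ∀ (a : ℤ) (q : ℕ), 0 < q → c / (q : ℝ) ^ l ≤ |X i / X j - (a : ℝ) / (q : ℝ)|) :
    ∃ (K : ℕ) (c2 : ℝ), 0 < c2 ∧ ∀ θ : ℝ, θ0 ≤ |θ| → c2 ≤ (1 + |θ|) ^ K * (1 - (phi p X θ).re) := by
  obtain ⟨K0, hK0⟩ := exists_nat_ge l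
  set a := X i
  set b := X j
  have ha : 0 < a := hX i
  have hb : 0 < b := hX j
  set κ := a / b
  have hκ : 0 < κ := by positivity
  set Q := 2 / (8 * p i) + 2 * κ ^ 2 / (8 * p j) with hQ
  have hpi := hp i
  have hpj := hp j
  have hQ0 : 0 < Q := by positivity
  refine ⟨2 * K0, min (8 * p j * (θ0 * b) ^ 2) ((c / (b + 1) ^ K0) ^ 2 / Q), by positivity, fun θ hθ => ?_⟩
  have hab := abs_nonneg θ
  have d1 := phi_re_bd (X := X) hp hs θ i
  have d2 := phi_re_bd (X := X) hp hs θ j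
  change 8 * p i * (θ * a - round (θ * a)) ^ 2 ≤ _ at d1
  change 8 * p j * (θ * b - round (θ * b)) ^ 2 ≤ _ at d2
  generalize hm : round (θ * a) = m at *
  set δ := 1 - (phi p X θ).re
  have hδ : 0 ≤ δ := le_trans (by positivity) d1
  have one : 1 ≤ (1 + |θ|) ^ (2 * K0) := one_le_pow₀ (by linarith)
  by_cases hq : round (θ * b) = 0
  · rw [hq] at d2
    refine (min_le_left _ _).trans ?_
    have : 8 * p j * (θ0 * b) ^ 2 ≤ δ := by
      refine le_trans ?_ d2
      have : (θ * b - ((0:ℤ):ℝ)) ^ 2 = (|θ| * b) ^ 2 := by rw [mul_pow, sq_abs]; push_cast; ring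
      rw [this]; gcongr
    nlinarith
  · refine (min_le_right _ _).trans ?_
    have hr := abs_sub_round (θ * b)
    generalize round (θ * b) = q at *
    have hqn : 0 < q.natAbs := Int.natAbs_pos.2 hq
    have h1 := hdio (q.sign * m) q.natAbs hqn
    have hqa : ((q.natAbs : ℕ) : ℝ) = |(q:ℝ)| := by
      rw [Nat.cast_natAbs, Int.cast_abs]
    have hq1 : 1 ≤ |(q:ℝ)| := by rw [← hqa]; exact_mod_cast hqn
    have hq0 : (q:ℝ) ≠ 0 := by exact_mod_cast hq
    rw [hqa] at h1
    have e1 : ((q.sign * m : ℤ) : ℝ) / |(q:ℝ)| = m / q := by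
      have : ((q.sign : ℤ) : ℝ) * q = |(q:ℝ)| := by
        have := Int.sign_mul_self_eq_abs q
        exact_mod_cast this
      have h0 : |(q:ℝ)| ≠ 0 := by positivity
      field_simp
      push_cast
      linear_combination (m:ℝ) * this
    rw [e1] at h1
    change _ ≤ |κ - _| at h1
    have h2 : c / |(q:ℝ)| ^ K0 ≤ |κ - m / q| := by
      refine le_trans ?_ h1
      gcongr
      rw [← Real.rpow_natCast]
      exact Real.rpow_le_rpow_of_exponent_le hq1 hK0
    have h3 : |κ - m / q| ≤ |(θ * a - m) - κ * (θ * b - q)| := by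
      have : (θ * a - m) - κ * (θ * b - q) = q * (κ - m / q) := by
        simp only [κ]; field_simp; ring
      rw [this, abs_mul]
      nlinarith [abs_nonneg (κ - m / q)]
    have h4 : |(q:ℝ)| ≤ (b + 1) * (1 + |θ|) := by
      have : |(q:ℝ)| ≤ |θ * b| + |θ * b - q| := by
        have := abs_sub (θ * b) (θ * b - q)
        simpa using this
      rw [abs_mul, abs_of_pos hb] at this
      nlinarith
    have h5 : c / ((b + 1) * (1 + |θ|)) ^ K0 ≤ |(θ * a - m) - κ * (θ * b - q)| := by
      refine le_trans ?_ (h2.trans h3)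
      gcongr
    have h6 : ((θ * a - m) - κ * (θ * b - q)) ^ 2 ≤ Q * δ := by
      have f1 : (θ * a - m) ^ 2 ≤ δ / (8 * p i) := by
        rw [le_div_iff₀ (by positivity)]; linarith
      have f2 : (θ * b - q) ^ 2 ≤ δ / (8 * p j) := by
        rw [le_div_iff₀ (by positivity)]; linarith
      have f3 : ((θ * a - m) - κ * (θ * b - q)) ^ 2 ≤ 2 * (θ * a - m) ^ 2 + 2 * κ ^ 2 * (θ * b - q) ^ 2 := by
        nlinarith [sq_nonneg ((θ * a - m) + κ * (θ * b - q))]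
      have f4 : 2 * κ ^ 2 * (θ * b - q) ^ 2 ≤ 2 * κ ^ 2 * (δ / (8 * p j)) := by gcongr
      have f5 : Q * δ = 2 * (δ / (8 * p i)) + 2 * κ ^ 2 * (δ / (8 * p j)) := by rw [hQ]; ring
      linarith
    have h7 : (c / ((b + 1) * (1 + |θ|)) ^ K0) ^ 2 ≤ Q * δ := by
      rw [← sq_abs ((θ * a - m) - κ * (θ * b - q))] at h6
      refine le_trans ?_ h6
      gcongr
    rw [div_le_iff₀ hQ0]
    have e : (c / ((b + 1) * (1 + |θ|)) ^ K0) ^ 2 = (c / (b + 1) ^ K0) ^ 2 / (1 + |θ|) ^ (2 * K0) := by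
      rw [mul_pow, div_pow, div_pow, mul_pow, ← pow_mul (1 + |θ|), mul_comm K0 2]
      field_simp
    rw [e, div_le_iff₀ (by positivity)] at h7
    linarith

/-- the main smoothing estimate -/
lemma main_est (hp : ∀ k, 0 < p k) (hs : ∑ k, p k = 1) (x0 : ℝ) (hx0 : 0 < x0) (hX : ∀ k, x0 ≤ X k) (θ0 c1 c2 : ℝ) (hθ0 : 0 < θ0) (hθ1 : θ0 ≤ 1)
    (hc1 : 0 < c1) (hc2 : 0 < c2) (K : ℕ)
    (h1 : ∀ θ : ℝ, |θ| ≤ θ0 → c1 * |θ| ≤ ‖1 - phi p X θ‖)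
    (h2 : ∀ θ : ℝ, θ0 ≤ |θ| → c2 ≤ (1 + |θ|) ^ K * (1 - (phi p X θ).re))
    (χ : ℝ → ℂ) (hχ : TF χ) (hI : 𝓕 (hh χ 0) 0 ≠ 0) :
    ∃ C > 0, ∀ (lam t : ℝ) (n N : ℕ), 1 ≤ n →
      ‖TT p X n N (hh χ lam) t‖ ≤ C / (1 + |lam|) + C * (1 + |lam|) ^ (2 * K + 2) / n := by
  obtain ⟨Ca, hCa, Ha⟩ := L1 (2 * K + 2) χ hχ
  obtain ⟨Cb, hCb, Hb⟩ := L2 χ hχ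
  obtain ⟨Cc, hCc, Hc⟩ := L3 χ hχ
  set I0 := 𝓕 (hh χ 0) 0 with hI0
  have hI0' : 0 < ‖I0‖ := norm_pos_iff.2 hI
  -- uniform bound for the reference function
  obtain ⟨B, hB⟩ : ∃ B, ∀ t, ‖hh χ 0 t‖ ≤ B :=
    (hχ.hh 0).cpt.exists_bound_of_continuous (hχ.hh 0).smooth.continuous
  obtain ⟨R, hR0, hR⟩ : ∃ R, 0 < R ∧ ∀ t, R < |t| → hh χ 0 t = 0 := by
    obtain ⟨R, hR0, hR⟩ := (hχ.hh 0).cpt.exists_pos_le_norm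
    exact ⟨R, hR0, fun t ht => hR t ht.le⟩
  have hB0 : 0 ≤ B := (norm_nonneg _).trans (hB 0)
  have hTref := TT_bd (X := X) hp hs x0 hx0 hX R B hR0 (hh χ 0) hB hR
  set B1 := B * (2 * R / x0 + 1) with hB1
  have hB10 : 0 ≤ B1 := by positivity
  -- constants
  set D1 := (Cc + Cb / ‖I0‖ * Cc) * (2 / c1) with hD1
  set D2 := (Ca + Cb / ‖I0‖ * Ca) * (8 / c2 ^ 2) with hD2
  have hD10 : 0 < D1 := by positivity
  have hD20 : 0 < D2 := by positivity
  set J := ∫ θ : ℝ, (1 + θ ^ 2)⁻¹ with hJ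
  have hJ0 : 0 ≤ J := integral_nonneg fun θ => by positivity
  refine ⟨Cb / ‖I0‖ * B1 + 2 * D1 * J + D2 * J + 1, by positivity, fun lam t n N hn => ?_⟩
  set cc := 𝓕 (hh χ lam) 0 / I0 with hcc
  have hl := abs_nonneg lam
  have hn' : (1:ℝ) ≤ n := by exact_mod_cast hn
  have hccb : ‖cc‖ ≤ Cb / ‖I0‖ / (1 + |lam|) := by
    have := Hb lam 0
    rw [hcc, norm_div, div_div, div_le_div_iff₀ hI0' (by positivity)]
    simp at this
    calc _ = ((1 + |lam|) * ‖𝓕 (hh χ lam) 0‖) * ‖I0‖ := by ring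
      _ ≤ _ := by gcongr
  set kh : ℝ → ℂ := fun θ => 𝓕 (hh χ lam) θ - cc * 𝓕 (hh χ 0) θ with hkh
  have hkint : Integrable kh := (integrable_four hχ lam).sub ((integrable_four hχ 0).const_mul cc)
  set kk : ℝ → ℂ := fun t => hh χ lam t - cc * hh χ 0 t with hkk
  have mee : ∀ t : ℝ, Continuous fun θ : ℝ => ee θ t := fun t => by
    unfold ee; fun_prop
  have iee : ∀ (f : ℝ → ℂ), Integrable f → ∀ t : ℝ, Integrable fun θ : ℝ => f θ * ee θ t := by
    intro f hf t
    exact hf.mul_bdd (c := 1) (mee t).aestronglyMeasurable (ae_of_all _ fun θ => (norm_ee θ t).le)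
  have hrel : Rel volume kk (fun θ t => kh θ * ee θ t) := by
    intro t
    refine ⟨iee _ hkint t, ?_⟩
    have e1 := inversion hχ lam t
    have e2 := inversion hχ 0 t
    have i1 := iee _ (integrable_four hχ lam) t
    have i2 := (iee _ (integrable_four hχ 0) t).const_mul cc
    simp only [hkk, hkh, sub_mul, mul_assoc cc]
    rw [integral_sub i1 i2, integral_const_mul]
    rw [e1, e2]; rfl
  have hrel2 := (hrel.tt (p := p) (X := X) n N) t
  simp only [TT_ee] at hrel2
  have hsplit : TT p X n N (hh χ lam) t = TT p X n N kk t + cc * TT p X n N (hh χ 0) t := by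
    have : hh χ lam = fun t => kk t + cc * hh χ 0 t := by ext t; simp [hkk]
    conv_lhs => rw [this]
    rw [TT_lin]
  -- pointwise bound
  have hpt : ∀ θ : ℝ, ‖kh θ * mult p X n N θ * ee θ t‖ ≤
      (2 * D1 / (1 + |lam|) + D2 * (1 + |lam|) ^ (2 * K + 2) / n) * (1 + θ ^ 2)⁻¹ := by
    intro θ
    rw [norm_mul, norm_ee, mul_one, norm_mul]
    have habs := abs_nonneg θ
    rcases le_total |θ| θ0 with hθ | hθ
    · have hθ1' : |θ| ≤ 1 := hθ.trans hθ1
      have hk : ‖kh θ‖ ≤ (Cc + Cb / ‖I0‖ * Cc) * |θ| / (1 + |lam|) := by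
        have e : kh θ = (𝓕 (hh χ lam) θ - 𝓕 (hh χ lam) 0) - cc * (𝓕 (hh χ 0) θ - I0) := by
          simp only [hkh, hcc]; field_simp; ring
        rw [e]
        have a1 := Hc lam θ hθ1'
        have a2 := Hc 0 θ hθ1'
        simp only [abs_zero, add_zero, one_mul] at a2
        refine (norm_sub_le _ _).trans ?_
        rw [norm_mul]
        have a1' : ‖𝓕 (hh χ lam) θ - 𝓕 (hh χ lam) 0‖ ≤ Cc * |θ| / (1 + |lam|) := by
          rw [le_div_iff₀ (by positivity)]; linarith
        calc _ ≤ Cc * |θ| / (1 + |lam|) + Cb / ‖I0‖ / (1 + |lam|) * (Cc * |θ|) := by gcongr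
          _ = _ := by ring
      by_cases h0 : θ = 0
      · have : ‖kh θ‖ = 0 := by
          apply le_antisymm _ (norm_nonneg _)
          rw [h0] at hk ⊢; simpa using hk
        rw [this, zero_mul]; positivity
      · have hθp : 0 < |θ| := abs_pos.2 h0
        have hm := mult_small (X := X) hp hs n N θ (c1 * |θ|) (by positivity) (h1 θ hθ)
        have q1 : (1:ℝ) / 2 ≤ (1 + θ ^ 2)⁻¹ := by
          rw [one_div]; apply inv_anti₀ (by positivity)
          nlinarith [sq_abs θ]
        calc ‖kh θ‖ * ‖mult p X n N θ‖ ≤ ((Cc + Cb / ‖I0‖ * Cc) * |θ| / (1 + |lam|)) * (2 / (c1 * |θ|)) := by gcongr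
          _ = (2 * D1 / (1 + |lam|)) * (1 / 2) := by rw [hD1]; field_simp
          _ ≤ (2 * D1 / (1 + |lam|) + D2 * (1 + |lam|) ^ (2 * K + 2) / n) * (1 / 2) := by
            gcongr; simp; positivity
          _ ≤ _ := by gcongr
    · have hd := h2 θ hθ
      have hm := mult_large (X := X) hp hs n N hn θ (c2 / (1 + |θ|) ^ K) (by positivity) (by
        rw [div_le_iff₀ (by positivity)]; linarith)
      have hk : ‖kh θ‖ ≤ (Ca + Cb / ‖I0‖ * Ca) * (1 + |lam|) ^ (2 * K + 2) / (1 + |θ|) ^ (2 * K + 2) := by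
        rw [le_div_iff₀ (by positivity)]
        have a1 := Ha lam θ
        have a2 := Ha 0 θ
        simp only [abs_zero, add_zero, one_pow, mul_one] at a2
        have hcc' : ‖cc‖ ≤ Cb / ‖I0‖ * (1 + |lam|) ^ (2 * K + 2) := by
          refine hccb.trans ?_
          calc _ ≤ Cb / ‖I0‖ := div_le_self (by positivity) (by linarith)
            _ ≤ _ := le_mul_of_one_le_right (by positivity) (one_le_pow₀ (by linarith))
        calc ‖kh θ‖ * (1 + |θ|) ^ (2 * K + 2) ≤ (‖𝓕 (hh χ lam) θ‖ + ‖cc‖ * ‖𝓕 (hh χ 0) θ‖) * (1 + |θ|) ^ (2 * K + 2) := by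
              gcongr
              refine (norm_sub_le _ _).trans ?_
              rw [norm_mul]
          _ = (1 + |θ|) ^ (2 * K + 2) * ‖𝓕 (hh χ lam) θ‖ + ‖cc‖ * ((1 + |θ|) ^ (2 * K + 2) * ‖𝓕 (hh χ 0) θ‖) := by ring
          _ ≤ Ca * (1 + |lam|) ^ (2 * K + 2) + (Cb / ‖I0‖ * (1 + |lam|) ^ (2 * K + 2)) * Ca := by gcongr
          _ = _ := by ring
      have q1 : (1 + |θ|) ^ (2 * K) / (1 + |θ|) ^ (2 * K + 2) ≤ (1 + θ ^ 2)⁻¹ := by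
        rw [pow_add]
        rw [div_mul_cancel_left₀ (by positivity)]
        apply inv_anti₀ (by positivity)
        nlinarith [sq_abs θ]
      calc ‖kh θ‖ * ‖mult p X n N θ‖ ≤ ((Ca + Cb / ‖I0‖ * Ca) * (1 + |lam|) ^ (2 * K + 2) / (1 + |θ|) ^ (2 * K + 2)) * (8 / (n * (c2 / (1 + |θ|) ^ K) ^ 2)) := by gcongr
        _ = (D2 * (1 + |lam|) ^ (2 * K + 2) / n) * ((1 + |θ|) ^ (2 * K) / (1 + |θ|) ^ (2 * K + 2)) := by
          rw [hD2, div_pow, ← pow_mul, mul_comm K 2]; field_simp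
        _ ≤ (2 * D1 / (1 + |lam|) + D2 * (1 + |lam|) ^ (2 * K + 2) / n) * (1 + θ ^ 2)⁻¹ := by
          gcongr; simp; positivity
  have hitg : ‖TT p X n N kk t‖ ≤ (2 * D1 / (1 + |lam|) + D2 * (1 + |lam|) ^ (2 * K + 2) / n) * J := by
    rw [hrel2.2, hJ, ← integral_const_mul]
    exact norm_integral_le_of_norm_le (integrable_inv_one_add_sq.const_mul _) (ae_of_all _ hpt)
  rw [hsplit]
  refine (norm_add_le _ _).trans ?_
  rw [norm_mul]
  have h3 : ‖cc‖ * ‖TT p X n N (hh χ 0) t‖ ≤ Cb / ‖I0‖ / (1 + |lam|) * B1 := by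
    gcongr; exact hTref n N t
  set Y := (1 + |lam|) ^ (2 * K + 2) / (n:ℝ) with hY
  have hY0 : 0 ≤ Y := by positivity
  set Z := (1 + |lam|)⁻¹ with hZ
  have hZ0 : 0 ≤ Z := by positivity
  simp only [div_eq_mul_inv _ (1 + |lam|), mul_div_assoc, ← hY, ← hZ] at hitg h3 ⊢
  have k1 : 0 ≤ (D2 * J + 1) * Z := by positivity
  have k2 : 0 ≤ (Cb / ‖I0‖ * B1 + 2 * D1 * J + 1) * Y := by positivity
  nlinarith
end phi
end S19

namespace S19
section frost
variable {A : Type*} [Fintype A] {r b p : A → ℝ} {μ : Measure ℝ} [IsProbabilityMeasure μ]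

lemma ss_real (hp : ∀ j, 0 < p j)
    (hss : μ = ∑ j, ENNReal.ofReal (p j) • Measure.map (fun y => r j * y + b j) μ)
    (S : Set ℝ) (hS : MeasurableSet S) :
    μ.real S = ∑ j, p j * μ.real ((fun y => r j * y + b j) ⁻¹' S) := by
  conv_lhs => rw [hss]
  rw [Measure.real, Measure.finsetSum_apply, ENNReal.toReal_sum]
  · refine Finset.sum_congr rfl fun j _ => ?_
    rw [Measure.smul_apply, Measure.map_apply (by fun_prop) hS, smul_eq_mul, ENNReal.toReal_mul,
      ENNReal.toReal_ofReal (hp j).le]; rfl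
  · intro j _
    rw [Measure.smul_apply, Measure.map_apply (by fun_prop) hS, smul_eq_mul]
    exact ENNReal.mul_ne_top ENNReal.ofReal_ne_top (measure_ne_top _ _)

lemma preim_ball (a c : ℝ) (ha : 0 < a) (z δ : ℝ) :
    (fun y => a * y + c) ⁻¹' Metric.closedBall z δ = Metric.closedBall ((z - c) / a) (δ / a) := by
  ext y
  simp only [Set.mem_preimage, Metric.mem_closedBall, Real.dist_eq]
  rw [le_div_iff₀ ha]
  have : a * y + c - z = (y - (z - c) / a) * a := by field_simp; ring
  rw [this, abs_mul, abs_of_pos ha]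

lemma frost_ind (hr : ∀ j, 0 < r j) (hp : ∀ j, 0 < p j) (hpsum : ∑ j, p j = 1)
    (F : Set ℝ) (hFss : F = ⋃ j, (fun y => r j * y + b j) '' F)
    (hss : μ = ∑ j, ENNReal.ofReal (p j) • Measure.map (fun y => r j * y + b j) μ)
    (s R : ℝ) (hs : 0 < s) (hs1 : s < 1) (hsr : ∀ j, s ≤ r j) (hR : ∀ j, r j ≤ R) (n : ℕ) :
    ∀ x ∈ F, ∃ c ρ β : ℝ, 0 < c ∧ c ≤ 1 ∧ 0 < ρ ∧ ρ ≤ R ^ n ∧ (∃ y ∈ F, x = ρ * y + β) ∧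
      ∀ B δ : ℝ, 0 ≤ δ → (∀ z, μ.real (Metric.closedBall z (δ / s ^ n)) ≤ B) →
        ∀ z, μ.real (Metric.closedBall z δ) ≤
          c * μ.real ((fun y => ρ * y + β) ⁻¹' Metric.closedBall z δ) + (1 - c) * B := by
  classical
  induction n with
  | zero =>
    intro x hx
    refine ⟨1, 1, 0, one_pos, le_rfl, one_pos, by simp, ⟨x, hx, by simp⟩, fun B δ _ _ z => ?_⟩
    simp
  | succ n ih =>
    intro x hx
    rw [hFss] at hx
    obtain ⟨k, x', hx', rfl⟩ := Set.mem_iUnion.1 hx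
    obtain ⟨c, ρ, β, hc, hc1, hρ, hρR, ⟨y, hy, rfl⟩, H⟩ := ih x' hx'
    have hpk1 : p k ≤ 1 := by
      rw [← hpsum]; exact Finset.single_le_sum (fun j _ => (hp j).le) (Finset.mem_univ k)
    have hR0 : 0 < R := (hr k).trans_le (hR k)
    refine ⟨p k * c, r k * ρ, r k * β + b k, mul_pos (hp k) hc, ?_, mul_pos (hr k) hρ, ?_,
      ⟨y, hy, by ring⟩, fun B δ hδ hB z => ?_⟩
    · exact mul_le_one₀ hpk1 hc.le hc1
    · rw [pow_succ, mul_comm]; exact mul_le_mul hρR (hR k) (hr k).le (by positivity)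
    rw [ss_real hp hss _ Metric.isClosed_closedBall.measurableSet, ← Finset.add_sum_erase _ _ (Finset.mem_univ k)]
    have hsn : 0 < s ^ n := by positivity
    have hsn1 : s ^ n ≤ 1 := pow_le_one₀ hs.le hs1.le
    have h1 : ∑ j ∈ Finset.univ.erase k, p j * μ.real ((fun y => r j * y + b j) ⁻¹' Metric.closedBall z δ)
        ≤ (1 - p k) * B := by
      calc _ ≤ ∑ j ∈ Finset.univ.erase k, p j * B := by
            refine Finset.sum_le_sum fun j _ => mul_le_mul_of_nonneg_left ?_ (hp j).le
            rw [preim_ball _ _ (hr j)]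
            refine le_trans (measureReal_mono (Metric.closedBall_subset_closedBall ?_)) (hB ((z - b j) / r j))
            rw [pow_succ]
            apply div_le_div_of_nonneg_left hδ (by positivity)
            nlinarith [hsr j]
        _ = _ := by
          rw [← Finset.sum_mul]
          have := Finset.add_sum_erase Finset.univ p (Finset.mem_univ k)
          rw [hpsum] at this
          rw [← this]; ring
    have h2 := H B (δ / r k) (div_nonneg hδ (hr k).le) (fun w => by
      refine le_trans (measureReal_mono (Metric.closedBall_subset_closedBall ?_)) (hB w)
      rw [pow_succ, div_div]
      apply div_le_div_of_nonneg_left hδ (by positivity)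
      nlinarith [hsr k]) ((z - b k) / r k)
    rw [← preim_ball _ _ (hr k)] at h2
    have e : (fun y => ρ * y + β) ⁻¹' ((fun y => r k * y + b k) ⁻¹' Metric.closedBall z δ)
      = (fun y => r k * ρ * y + (r k * β + b k)) ⁻¹' Metric.closedBall z δ := by
      rw [← Set.preimage_comp]; congr 1; ext y; simp only [Function.comp]; ring
    rw [e] at h2
    have h3 := mul_le_mul_of_nonneg_left h2 (hp k).le
    nlinarith

lemma frostman (hr : ∀ j, 0 < r j ∧ r j < 1) (hp : ∀ j, 0 < p j) (hpsum : ∑ j, p j = 1)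
    (F : Set ℝ) (hF1 : F ⊆ Set.Icc 0 1) (hFc : IsCompact F) (hFne : F.Nonempty)
    (hFss : F = ⋃ j, (fun y => r j * y + b j) '' F)
    (hFns : ¬ ∃ y, F = {y}) (hμF : μ F = 1)
    (hss : μ = ∑ j, ENNReal.ofReal (p j) • Measure.map (fun y => r j * y + b j) μ) :
    ∃ α > (0:ℝ), ∃ C > (0:ℝ), ∀ x δ : ℝ, 0 < δ → μ.real (Metric.closedBall x δ) ≤ C * δ ^ α := by
  classical
  have hne : Nonempty A := by
    by_contra h
    rw [not_nonempty_iff] at h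
    simp at hpsum
  obtain ⟨jm, hjm⟩ := Finite.exists_min r
  obtain ⟨jM, hjM⟩ := Finite.exists_max r
  obtain ⟨x, hx⟩ := hFne
  obtain ⟨y, hy, hxy⟩ : ∃ y ∈ F, y ≠ x := by
    by_contra! h
    exact hFns ⟨x, Set.eq_singleton_iff_unique_mem.2 ⟨hx, h⟩⟩
  have hd : 0 < |x - y| := abs_pos.2 (sub_ne_zero.2 hxy.symm)
  obtain ⟨n, hn⟩ := exists_pow_lt_of_lt_one (show 0 < |x - y| / 4 by positivity) (hr jM).2
  have ind := frost_ind (fun j => (hr j).1) hp hpsum F hFss hss (r jm) (r jM) (hr jm).1 (hr jm).2 hjm hjM n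
  obtain ⟨c1, ρ1, β1, hc1, hc1', hρ1, hρ1', ⟨x', hx', hxx⟩, H1⟩ := ind x hx
  obtain ⟨c2, ρ2, β2, hc2, hc2', hρ2, hρ2', ⟨y', hy', hyy⟩, H2⟩ := ind y hy
  set s := (r jm) ^ (n + 1) with hs
  have hs0 : 0 < s := pow_pos (hr jm).1 _
  have hs1 : s < 1 := pow_lt_one₀ (hr jm).1.le (hr jm).2 (by simp)
  set κ := max (1 / 2) (1 - min c1 c2) with hκ
  have hκ0 : 0 < κ := lt_of_lt_of_le (by norm_num) (le_max_left _ _)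
  have hκ1 : κ < 1 := max_lt (by norm_num) (by have := lt_min hc1 hc2; linarith)
  set d := |x - y| / 4 with hdd
  have hd0 : 0 < d := by positivity
  have hFc0 : μ.real Fᶜ = 0 := by
    have : μ Fᶜ = 0 := (prob_compl_eq_zero_iff hFc.measurableSet).2 hμF
    simp [Measure.real, this]
  have step : ∀ B δ : ℝ, 0 ≤ B → 0 ≤ δ → δ < d → (∀ z, μ.real (Metric.closedBall z (δ / s)) ≤ B) →
      ∀ z, μ.real (Metric.closedBall z δ) ≤ κ * B := by
    intro B δ hB hδ hδd h z
    have h' : ∀ z, μ.real (Metric.closedBall z (δ / r jm ^ n)) ≤ B := by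
      intro z
      refine le_trans (measureReal_mono (Metric.closedBall_subset_closedBall ?_)) (h z)
      apply div_le_div_of_nonneg_left hδ hs0
      exact pow_le_pow_of_le_one (hr jm).1.le (hr jm).2.le (by simp)
    have g1 := H1 B δ hδ h' z
    have g2 := H2 B δ hδ h' z
    by_cases hh1 : ∃ u ∈ F, ρ1 * u + β1 ∈ Metric.closedBall z δ
    · have hh2 : ¬ ∃ u ∈ F, ρ2 * u + β2 ∈ Metric.closedBall z δ := by
        rintro ⟨v, hv, hv2⟩
        obtain ⟨u, hu, hu2⟩ := hh1
        rw [Metric.mem_closedBall, Real.dist_eq] at hu2 hv2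
        have b1 := hF1 hu
        have b2 := hF1 hv
        have b3 := hF1 hx'
        have b4 := hF1 hy'
        have a1 : |x - (ρ1 * u + β1)| ≤ ρ1 := by
          rw [hxx]
          have : ρ1 * x' + β1 - (ρ1 * u + β1) = ρ1 * (x' - u) := by ring
          rw [this, abs_mul, abs_of_pos hρ1]
          have : |x' - u| ≤ 1 := abs_le.2 ⟨by linarith [b1.2, b3.1], by linarith [b1.1, b3.2]⟩
          nlinarith
        have a2 : |y - (ρ2 * v + β2)| ≤ ρ2 := by
          rw [hyy]
          have : ρ2 * y' + β2 - (ρ2 * v + β2) = ρ2 * (y' - v) := by ring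
          rw [this, abs_mul, abs_of_pos hρ2]
          have : |y' - v| ≤ 1 := abs_le.2 ⟨by linarith [b2.2, b4.1], by linarith [b2.1, b4.2]⟩
          nlinarith
        have : |x - y| < 4 * d := by
          rw [abs_lt]
          rw [abs_le] at a1 a2 hu2 hv2
          constructor <;> linarith [a1.1, a1.2, a2.1, a2.2, hu2.1, hu2.2, hv2.1, hv2.2]
        rw [hdd] at this; linarith
      have : μ.real ((fun y => ρ2 * y + β2) ⁻¹' Metric.closedBall z δ) = 0 := by
        apply le_antisymm _ measureReal_nonneg
        rw [← hFc0]
        refine measureReal_mono ?_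
        intro v hv hvF
        exact hh2 ⟨v, hvF, hv⟩
      rw [this, mul_zero, zero_add] at g2
      refine g2.trans (mul_le_mul_of_nonneg_right ?_ hB)
      refine le_trans ?_ (le_max_right _ _)
      linarith [min_le_right c1 c2]
    · have : μ.real ((fun y => ρ1 * y + β1) ⁻¹' Metric.closedBall z δ) = 0 := by
        apply le_antisymm _ measureReal_nonneg
        rw [← hFc0]
        refine measureReal_mono ?_
        intro v hv hvF
        exact hh1 ⟨v, hvF, hv⟩
      rw [this, mul_zero, zero_add] at g1
      refine g1.trans (mul_le_mul_of_nonneg_right ?_ hB)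
      refine le_trans ?_ (le_max_right _ _)
      linarith [min_le_left c1 c2]
  have iter : ∀ m : ℕ, ∀ δ : ℝ, 0 ≤ δ → δ < d * s ^ m → ∀ z, μ.real (Metric.closedBall z δ) ≤ κ ^ m := by
    intro m
    induction m with
    | zero => intro δ _ _ z; simp
    | succ m ih =>
      intro δ h0 h1 z
      rw [pow_succ, mul_comm]
      apply step _ _ (by positivity) h0
      · refine h1.trans_le ?_
        have : s ^ (m+1) ≤ 1 := pow_le_one₀ hs0.le hs1.le
        nlinarith
      · apply ih _ (by positivity)
        rw [div_lt_iff₀ hs0]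
        rwa [mul_assoc, ← pow_succ]
  have hlκ := Real.log_neg hκ0 hκ1
  have hls := Real.log_neg hs0 hs1
  set α := Real.log κ / Real.log s with hα
  have hα0 : 0 < α := div_pos_of_neg_of_neg hlκ hls
  refine ⟨α, hα0, κ⁻¹ * (d ^ α)⁻¹, by positivity, fun z δ hδ => ?_⟩
  have eq : κ⁻¹ * (d ^ α)⁻¹ * δ ^ α = κ⁻¹ * (δ / d) ^ α := by
    rw [Real.div_rpow hδ.le hd0.le]; ring
  rw [eq]
  have hκi : 1 ≤ κ⁻¹ := (one_le_inv₀ hκ0).2 hκ1.le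
  rcases le_or_gt d δ with h | h
  · have : 1 ≤ (δ / d) ^ α := Real.one_le_rpow ((one_le_div hd0).2 h) hα0.le
    have h1 : μ.real (Metric.closedBall z δ) ≤ 1 := measureReal_le_one
    nlinarith
  · have hq : 0 < δ / d := by positivity
    have hL : 0 < Real.log (δ / d) / Real.log s :=
      div_pos_of_neg_of_neg (Real.log_neg hq ((div_lt_one hd0).2 h)) hls
    set L := Real.log (δ / d) / Real.log s with hLdef
    have hc : 0 < ⌈L⌉₊ := Nat.ceil_pos.2 hL
    obtain ⟨m, hm⟩ : ∃ m, ⌈L⌉₊ = m + 1 := ⟨⌈L⌉₊ - 1, by omega⟩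
    have hmL : (m:ℝ) < L := by
      have := Nat.lt_ceil (n := m) (a := L)
      rw [hm] at this; exact this.1 (by simp)
    have hmL' : L ≤ m + 1 := by
      have := Nat.le_ceil L
      rw [hm] at this; exact_mod_cast this
    have hsL : s ^ L = δ / d := by
      rw [Real.rpow_def_of_pos hs0, hLdef, mul_div_cancel₀ _ hls.ne, Real.exp_log hq]
    have h1 : δ < d * s ^ m := by
      have : δ / d < s ^ m := by
        rw [← hsL, ← Real.rpow_natCast]
        exact Real.rpow_lt_rpow_of_exponent_gt hs0 hs1 hmL
      rw [div_lt_iff₀ hd0] at this; linarith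
    refine (iter m δ hδ.le h1 z).trans ?_
    have e2 : (δ / d) ^ α = κ ^ L := by
      rw [Real.rpow_def_of_pos hq, Real.rpow_def_of_pos hκ0, hα, hLdef]
      congr 1; ring
    rw [e2]
    have e3 : κ ^ (m + 1) ≤ κ ^ L := by
      rw [← Real.rpow_natCast]
      apply Real.rpow_le_rpow_of_exponent_ge hκ0 hκ1.le
      push_cast; exact hmL'
    rw [pow_succ] at e3
    rw [inv_mul_eq_div, le_div_iff₀ hκ0]; exact e3
end frost
end S19

namespace S19
open scoped FourierTransform ContDiff
section asm
variable {A : Type*} [Fintype A] {r b p : A → ℝ} {μ : Measure ℝ} [IsProbabilityMeasure μ]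

noncomputable def mh (μ : Measure ℝ) (ξ : ℝ) : ℂ :=
  ∫ y, Complex.exp (-2 * Real.pi * Complex.I * ξ * y) ∂μ

lemma norm_char (ξ y : ℝ) : ‖Complex.exp (-2 * Real.pi * Complex.I * ξ * y)‖ = 1 := by
  have : (-2 * Real.pi * Complex.I * ξ * y : ℂ) = ((-2 * Real.pi * ξ * y : ℝ) : ℂ) * Complex.I := by
    push_cast; ring
  rw [this, Complex.norm_exp_ofReal_mul_I]

lemma int_char (ν : Measure ℝ) [IsFiniteMeasure ν] (ξ : ℝ) :
    Integrable (fun y : ℝ => Complex.exp (-2 * Real.pi * Complex.I * ξ * y)) ν := by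
  refine (integrable_const (1:ℝ)).mono' (Continuous.aestronglyMeasurable (by fun_prop)) (ae_of_all _ fun y => ?_)
  rw [norm_char]

lemma mh_ss (hp : ∀ j, 0 < p j)
    (hss : μ = ∑ j, ENNReal.ofReal (p j) • Measure.map (fun y => r j * y + b j) μ) (ξ : ℝ) :
    mh μ ξ = ∑ j, (p j : ℂ) * (Complex.exp (-2 * Real.pi * Complex.I * ξ * b j) * mh μ (r j * ξ)) := by
  conv_lhs => rw [mh, hss]
  have hm : ∀ j, Measurable (fun y => r j * y + b j) := fun j => by fun_prop
  have : ∀ j, IsProbabilityMeasure (Measure.map (fun y => r j * y + b j) μ) :=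
    fun j => Measure.isProbabilityMeasure_map (hm j).aemeasurable
  rw [integral_finsetSum_measure]
  · refine Finset.sum_congr rfl fun j _ => ?_
    rw [integral_smul_measure, integral_map (hm j).aemeasurable
      (Continuous.aestronglyMeasurable (by fun_prop)), ENNReal.toReal_ofReal (hp j).le, mh,
      ← integral_const_mul, Complex.real_smul]
    congr 2; ext y
    rw [← Complex.exp_add]; congr 1; push_cast; ring
  · intro j _
    exact (int_char _ ξ).smul_measure ENNReal.ofReal_ne_top

lemma mh_sub (hp : ∀ j, 0 < p j) (hpsum : ∑ j, p j = 1)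
    (hss : μ = ∑ j, ENNReal.ofReal (p j) • Measure.map (fun y => r j * y + b j) μ) (ξ : ℝ) :
    ‖mh μ ξ‖ ^ 2 ≤ ∑ j, p j * ‖mh μ (r j * ξ)‖ ^ 2 := by
  have h1 : ‖mh μ ξ‖ ≤ ∑ j, p j * ‖mh μ (r j * ξ)‖ := by
    rw [mh_ss hp hss ξ]
    refine norm_sum_le_of_le _ fun j _ => ?_
    rw [norm_mul, norm_mul, norm_char, one_mul, Complex.norm_real, Real.norm_eq_abs, abs_of_pos (hp j)]
  have h2 : (∑ j, p j * ‖mh μ (r j * ξ)‖) ^ 2 ≤ ∑ j, p j * ‖mh μ (r j * ξ)‖ ^ 2 :=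
    Real.pow_arith_mean_le_arith_mean_pow _ _ _ (fun j _ => (hp j).le) hpsum (fun _ _ => norm_nonneg _) 2
  exact (pow_le_pow_left₀ (norm_nonneg _) h1 2).trans h2

lemma g_sub (hr : ∀ j, 0 < r j) (hp : ∀ j, 0 < p j) (hpsum : ∑ j, p j = 1)
    (hss : μ = ∑ j, ENNReal.ofReal (p j) • Measure.map (fun y => r j * y + b j) μ) (M t : ℝ) :
    ‖mh μ (Real.exp (t + M))‖ ^ 2 ≤
      Pop p (fun k => -Real.log (r k)) (fun s => ‖mh μ (Real.exp (s + M))‖ ^ 2) t := by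
  refine (mh_sub hp hpsum hss _).trans (le_of_eq ?_)
  simp only [Pop, smul_eq_mul]
  refine Finset.sum_congr rfl fun k _ => ?_
  have : Real.exp (t - -Real.log (r k) + M) = r k * Real.exp (t + M) := by
    rw [show t - -Real.log (r k) + M = Real.log (r k) + (t + M) by ring, Real.exp_add,
      Real.exp_log (hr k)]
  rw [this]

lemma Pop_mono (hp : ∀ j, 0 < p j) (X : A → ℝ) (u v : ℝ → ℝ) (t : ℝ) (h : ∀ k, u (t - X k) ≤ v (t - X k)) :
    Pop p X u t ≤ Pop p X v t := by
  simp only [Pop, smul_eq_mul]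
  exact Finset.sum_le_sum fun k _ => mul_le_mul_of_nonneg_left (h k) (hp k).le

lemma WN_nonneg (hp : ∀ j, 0 < p j) (X : A → ℝ) (f : ℝ → ℝ) (hf : ∀ s, 0 ≤ f s) (N : ℕ) (s : ℝ) :
    0 ≤ WN p X N f s := by
  induction N generalizing s with
  | zero => simp [WN]
  | succ N ih =>
    simp only [WN]
    exact add_nonneg (hf s) (Finset.sum_nonneg fun k _ => mul_nonneg (hp k).le (ih _))

lemma WN_ge (hp : ∀ j, 0 < p j) (X : A → ℝ) (x0 D : ℝ) (hx : ∀ k, x0 ≤ X k) (hD : ∀ k, X k ≤ D)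
    (g f : ℝ → ℝ) (hf : ∀ s, 0 ≤ f s) (hfg : ∀ s, -D ≤ s → s ≤ 0 → g s ≤ f s)
    (hg : ∀ s, g s ≤ Pop p X g s) (N : ℕ) (s : ℝ) (h1 : -D ≤ s) (h2 : s ≤ N * x0) :
    g s ≤ WN p X (N + 1) f s := by
  induction N generalizing s with
  | zero =>
    simp only [WN]
    have : Pop p X (fun _ => (0:ℝ)) s = 0 := by simp [Pop]
    rw [this, add_zero]
    exact hfg s h1 (by simpa using h2)
  | succ N ih =>
    rw [WN]
    rcases le_or_gt s 0 with h | h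
    · have : 0 ≤ Pop p X (WN p X (N + 1) f) s :=
        Finset.sum_nonneg fun k _ => mul_nonneg (hp k).le (WN_nonneg hp X f hf _ _)
      have := hfg s h1 h
      linarith
    · have h3 : Pop p X g s ≤ Pop p X (WN p X (N + 1) f) s := by
        refine Pop_mono hp X _ _ _ fun k => ih _ (by linarith [hD k]) ?_
        push_cast at h2
        linarith [hx k]
      linarith [hg s, hf s]

lemma TT_ge (hp : ∀ j, 0 < p j) (X : A → ℝ) (x0 D : ℝ) (hx0 : 0 < x0) (hx : ∀ k, x0 ≤ X k) (hD : ∀ k, X k ≤ D)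
    (g f : ℝ → ℝ) (hf : ∀ s, 0 ≤ f s) (hfg : ∀ s, -D ≤ s → s ≤ 0 → g s ≤ f s)
    (hg : ∀ s, g s ≤ Pop p X g s) (n N : ℕ) (s : ℝ) (h1 : -D + n * D ≤ s) (h2 : s ≤ N * x0)
    (hD0 : 0 < D) :
    g s ≤ TT p X n (N + 1) f s := by
  induction n generalizing s with
  | zero => exact WN_ge hp X x0 D hx hD g f hf hfg hg N s (by simpa using h1) h2
  | succ n ih =>
    push_cast at h1
    simp only [TT, LzN, Lz, smul_eq_mul] at ih ⊢
    have e1 := ih s (by linarith) h2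
    have e2 := Pop_mono hp X _ _ s fun k => ih (s - X k) (by linarith [hD k]) (by linarith [hx k])
    have := hg s
    linarith

lemma mh_sq (ξ : ℝ) : ((‖mh μ ξ‖ ^ 2 : ℝ) : ℂ) =
    ∫ z : ℝ × ℝ, Complex.exp (-2 * Real.pi * Complex.I * ξ * (z.1 - z.2 : ℝ)) ∂(μ.prod μ) := by
  have h1 : (starRingEnd ℂ) (mh μ ξ) = ∫ y, Complex.exp (2 * Real.pi * Complex.I * ξ * y) ∂μ := by
    rw [mh, ← integral_conj]
    congr 1; ext y
    rw [← Complex.exp_conj]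
    congr 1
    simp [map_ofNat]
  push_cast
  rw [← Complex.mul_conj', h1, mh, ← integral_prod_mul]
  congr 1; ext z
  rw [← Complex.exp_add]; congr 1; push_cast; ring

lemma mh_neg (ξ : ℝ) : ‖mh μ (-ξ)‖ = ‖mh μ ξ‖ := by
  rw [← RCLike.norm_conj (mh μ ξ), mh, mh, ← integral_conj]
  congr 2; ext y
  rw [← Complex.exp_conj]
  congr 1
  simp [map_ofNat]

lemma mh_abs (ξ : ℝ) : ‖mh μ |ξ|‖ = ‖mh μ ξ‖ := by
  rcases abs_choice ξ with h | h
  · rw [h]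
  · rw [h, mh_neg]

lemma rel_f (χ : ℝ → ℝ) (M : ℝ) :
    Rel (μ.prod μ) (fun s => ((χ s * ‖mh μ (Real.exp (s + M))‖ ^ 2 : ℝ) : ℂ))
      (fun z => hh (fun s => (χ s : ℂ)) (Real.exp M * (z.1 - z.2))) := by
  intro t
  have e : ∀ z : ℝ × ℝ, hh (fun s => (χ s : ℂ)) (Real.exp M * (z.1 - z.2)) t =
      (χ t : ℂ) * Complex.exp (-2 * Real.pi * Complex.I * (Real.exp (t + M) : ℝ) * (z.1 - z.2 : ℝ)) := by
    intro z
    rw [hh]; congr 2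
    rw [Real.exp_add]; push_cast; ring
  simp only [e]
  constructor
  · refine Integrable.const_mul ?_ _
    refine (integrable_const (1:ℝ)).mono' (Continuous.aestronglyMeasurable (by fun_prop)) (ae_of_all _ fun y => ?_)
    rw [norm_char]
  · rw [integral_const_mul, ← mh_sq]
    push_cast; rfl

lemma energy (α C : ℝ) (hfr : ∀ x δ : ℝ, 0 < δ → μ.real (Metric.closedBall x δ) ≤ C * δ ^ α)
    (L δ : ℝ) (hL : 0 < L) (hδ : 0 < δ) :
    ∫ z : ℝ × ℝ, 1 / (1 + |L * (z.1 - z.2)|) ∂(μ.prod μ) ≤ C * δ ^ α + 1 / (1 + L * δ) := by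
  have hpos : ∀ z : ℝ × ℝ, 0 < 1 + |L * (z.1 - z.2)| := fun z => by positivity
  have hle : ∀ z : ℝ × ℝ, 1 / (1 + |L * (z.1 - z.2)|) ≤ 1 := fun z => by
    rw [div_le_one (hpos z)]; linarith [abs_nonneg (L * (z.1 - z.2))]
  have hcont : Continuous fun z : ℝ × ℝ => 1 / (1 + |L * (z.1 - z.2)|) :=
    continuous_const.div (by fun_prop) fun z => (hpos z).ne'
  have hitg : Integrable (fun z : ℝ × ℝ => 1 / (1 + |L * (z.1 - z.2)|)) (μ.prod μ) := by
    refine (integrable_const (1:ℝ)).mono' hcont.aestronglyMeasurable (ae_of_all _ fun z => ?_)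
    rw [Real.norm_eq_abs, abs_of_pos (one_div_pos.2 (hpos z))]; exact hle z
  rw [integral_prod _ hitg]
  have hin : ∀ x : ℝ, ∫ y, 1 / (1 + |L * (x - y)|) ∂μ ≤ C * δ ^ α + 1 / (1 + L * δ) := by
    intro x
    have hb : ∫ y, (Metric.closedBall x δ).indicator (fun _ => (1:ℝ)) y + 1 / (1 + L * δ) ∂μ
        = μ.real (Metric.closedBall x δ) + 1 / (1 + L * δ) := by
      rw [integral_add ((integrable_const _).indicator Metric.isClosed_closedBall.measurableSet) (integrable_const _),
        integral_indicator_const _ Metric.isClosed_closedBall.measurableSet]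
      simp
    refine le_trans (integral_mono_of_nonneg (ae_of_all _ fun y => (one_div_pos.2 (hpos (x, y))).le)
      (((integrable_const _).indicator Metric.isClosed_closedBall.measurableSet).add (integrable_const _))
      (ae_of_all _ fun y => ?_)) (hb.le.trans (by linarith [hfr x δ hδ]))
    show 1 / (1 + |L * (x - y)|) ≤ (Metric.closedBall x δ).indicator (fun _ => (1:ℝ)) y + 1 / (1 + L * δ)
    have h0 : 0 < 1 / (1 + L * δ) := by positivity
    by_cases hy : y ∈ Metric.closedBall x δ
    · rw [Set.indicator_of_mem hy]
      linarith [hle (x, y)]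
    · rw [Set.indicator_of_notMem hy, zero_add]
      rw [Metric.mem_closedBall, not_le, Real.dist_eq, abs_sub_comm] at hy
      apply one_div_le_one_div_of_le (by positivity)
      rw [abs_mul, abs_of_pos hL]
      nlinarith
  calc _ ≤ ∫ x, (C * δ ^ α + 1 / (1 + L * δ)) ∂μ :=
        integral_mono hitg.integral_prod_left (integrable_const _) hin
    _ = _ := by simp

/-- the bump function used for the initial data -/
lemma exists_bump (D : ℝ) (hD : 0 < D) : ∃ χ : ℝ → ℝ, TF (fun s => (χ s : ℂ)) ∧ (∀ s, 0 ≤ χ s) ∧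
    (∀ s, |s| ≤ D → χ s = 1) ∧ 𝓕 (hh (fun s => (χ s : ℂ)) 0) 0 ≠ 0 := by
  let B : ContDiffBump (0:ℝ) := ⟨D, D + 1, hD, by linarith⟩
  have h1 : TF (fun s => ((B s : ℝ) : ℂ)) :=
    ⟨Complex.ofRealCLM.contDiff.comp B.contDiff,
      B.hasCompactSupport.comp_left (g := fun x : ℝ => (x : ℂ)) (by simp)⟩
  refine ⟨B, h1, fun s => B.nonneg, fun s hs => B.one_of_mem_closedBall (by simpa using hs), ?_⟩
  rw [Real.fourier_eq']
  have : ∀ v : ℝ, Complex.exp (((-2 * Real.pi * inner ℝ v (0:ℝ) : ℝ) : ℂ) * Complex.I) • hh (fun s => ((B s : ℝ) : ℂ)) 0 v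
      = ((B v : ℝ) : ℂ) := by
    intro v; simp [hh]
  simp only [this]
  rw [integral_complex_ofReal]
  exact_mod_cast (B.integral_pos (μ := volume)).ne'

end asm
end S19

namespace S19
section fin
variable {A : Type*} [Fintype A] {r b p : A → ℝ} {μ : Measure ℝ} [IsProbabilityMeasure μ]

/-- bound on the squared Fourier transform with free parameters -/
lemma core (hr : ∀ j, 0 < r j) (hp : ∀ j, 0 < p j) (hpsum : ∑ j, p j = 1)
    (hss : μ = ∑ j, ENNReal.ofReal (p j) • Measure.map (fun y => r j * y + b j) μ)
    (F : Set ℝ) (hF1 : F ⊆ Set.Icc 0 1) (hFc : IsCompact F) (hμF : μ F = 1)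
    (X : A → ℝ) (hX : X = fun k => -Real.log (r k)) (x0 D : ℝ) (hx0 : 0 < x0) (hD0 : 0 < D)
    (hx : ∀ k, x0 ≤ X k) (hD : ∀ k, X k ≤ D)
    (χ : ℝ → ℝ) (hχ0 : ∀ s, 0 ≤ χ s) (hχ1 : ∀ s, |s| ≤ D → χ s = 1) (C : ℝ) (hC : 0 < C) (K : ℕ)
    (hest : ∀ (lam t : ℝ) (n N : ℕ), 1 ≤ n →
      ‖TT p X n N (hh (fun s => (χ s : ℂ)) lam) t‖ ≤ C / (1 + |lam|) + C * (1 + |lam|) ^ K / n)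
    (α C' : ℝ) (hfr : ∀ x δ : ℝ, 0 < δ → μ.real (Metric.closedBall x δ) ≤ C' * δ ^ α)
    (M δ s : ℝ) (hδ : 0 < δ) (hs : 0 < s) :
    ‖mh μ (Real.exp (s + M))‖ ^ 2 ≤ C * (C' * δ ^ α + 1 / (1 + Real.exp M * δ))
      + C * (1 + Real.exp M) ^ K * (D / s) := by
  obtain ⟨N, hN⟩ := exists_nat_ge (s / x0)
  have hN' : s ≤ N * x0 := by rwa [div_le_iff₀ hx0] at hN
  set n : ℕ := ⌊s / D⌋₊ + 1 with hn
  have hn1 : -D + n * D ≤ s := by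
    have := Nat.floor_le (div_pos hs hD0).le
    rw [le_div_iff₀ hD0] at this
    rw [hn]; push_cast; linarith
  have hn2 : s / D < n := by rw [hn]; push_cast; exact Nat.lt_floor_add_one _
  have hn0 : (0:ℝ) < n := lt_of_le_of_lt (div_pos hs hD0).le hn2
  set f : ℝ → ℝ := fun s => χ s * ‖mh μ (Real.exp (s + M))‖ ^ 2 with hf
  have step1 : ‖mh μ (Real.exp (s + M))‖ ^ 2 ≤ TT p X n (N + 1) f s := by
    refine TT_ge hp X x0 D hx0 hx hD (fun s => ‖mh μ (Real.exp (s + M))‖ ^ 2) f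
      (fun s => mul_nonneg (hχ0 s) (by positivity)) (fun s h1 h2 => ?_) (fun s => ?_) n N s hn1 hN' hD0
    · simp only [hf]
      rw [hχ1 s (abs_le.2 ⟨h1, by linarith⟩), one_mul]
    · rw [hX]; exact g_sub hr hp hpsum hss M s
  have hrel := ((rel_f (μ := μ) χ M).tt (p := p) (X := X) n (N + 1) s)
  rw [TT_ofReal] at hrel
  have step2 : TT p X n (N + 1) f s ≤
      ‖∫ z : ℝ × ℝ, TT p X n (N + 1) (hh (fun s => (χ s : ℂ)) (Real.exp M * (z.1 - z.2))) s ∂(μ.prod μ)‖ := by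
    rw [← hrel.2, Complex.norm_real]
    exact le_abs_self _
  have hFae : ∀ᵐ x ∂μ, x ∈ F := by
    rw [← prob_compl_eq_zero_iff hFc.measurableSet] at hμF
    exact hμF
  have hae : ∀ᵐ z ∂(μ.prod μ), |z.1 - z.2| ≤ 1 := by
    have a1 : ∀ᵐ z ∂(μ.prod μ), z.1 ∈ F := Measure.quasiMeasurePreserving_fst.ae hFae
    have a2 : ∀ᵐ z ∂(μ.prod μ), z.2 ∈ F := Measure.quasiMeasurePreserving_snd.ae hFae
    filter_upwards [a1, a2] with z h1 h2
    have := hF1 h1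
    have := hF1 h2
    simp only [Set.mem_Icc] at *
    rw [abs_le]; constructor <;> linarith
  have hL : 0 < Real.exp M := Real.exp_pos M
  set Q : ℝ := C * (1 + Real.exp M) ^ K * (D / s) with hQ
  have hitg : Integrable (fun z : ℝ × ℝ => 1 / (1 + |Real.exp M * (z.1 - z.2)|)) (μ.prod μ) := by
    have hpos : ∀ z : ℝ × ℝ, 0 < 1 + |Real.exp M * (z.1 - z.2)| := fun z => by positivity
    refine (integrable_const (1:ℝ)).mono' (Continuous.aestronglyMeasurable
      (continuous_const.div (by fun_prop) fun z => (hpos z).ne')) (ae_of_all _ fun z => ?_)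
    rw [Real.norm_eq_abs, abs_of_pos (one_div_pos.2 (hpos z)), div_le_one (hpos z)]
    linarith [abs_nonneg (Real.exp M * (z.1 - z.2))]
  have step3 : ‖∫ z : ℝ × ℝ, TT p X n (N + 1) (hh (fun s => (χ s : ℂ)) (Real.exp M * (z.1 - z.2))) s ∂(μ.prod μ)‖
      ≤ ∫ z : ℝ × ℝ, (C * (1 / (1 + |Real.exp M * (z.1 - z.2)|)) + Q) ∂(μ.prod μ) := by
    refine norm_integral_le_of_norm_le ((hitg.const_mul C).add (integrable_const Q)) ?_
    filter_upwards [hae] with z hz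
    refine (hest _ s n (N + 1) (by omega)).trans ?_
    have hlam : |Real.exp M * (z.1 - z.2)| ≤ Real.exp M := by
      rw [abs_mul, abs_of_pos hL]; nlinarith
    have e1 : C * (1 + |Real.exp M * (z.1 - z.2)|) ^ K / n ≤ Q := by
      rw [hQ, div_eq_mul_inv]
      have : (n:ℝ)⁻¹ ≤ D / s := by
        rw [← inv_div]; exact inv_anti₀ (div_pos hs hD0) hn2.le
      gcongr
    rw [mul_one_div]
    linarith
  rw [integral_add (hitg.const_mul C) (integrable_const Q), integral_const_mul, integral_const] at step3
  have := energy α C' hfr (Real.exp M) δ hL hδ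
  have := mul_le_mul_of_nonneg_left this hC.le
  simp only [probReal_univ, one_smul] at step3
  linarith

/-- choice of parameters -/
lemma choice (K : ℕ) (hK : 1 ≤ K) (α C C' D : ℝ) (hα : 0 < α) (hC : 0 < C) (hC' : 0 < C') (hD : 0 < D)
    (g : ℝ → ℝ)
    (H : ∀ M δ s : ℝ, 0 < δ → 0 < s → g (s + M) ≤ C * (C' * δ ^ α + 1 / (1 + Real.exp M * δ))
      + C * (1 + Real.exp M) ^ K * (D / s)) :
    ∃ γ > (0:ℝ), ∃ C'' > (0:ℝ), ∀ t : ℝ, 1 ≤ t → g t ≤ C'' / t ^ γ := by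
  have hK' : (1:ℝ) ≤ K := by exact_mod_cast hK
  set κ : ℝ := 1 / (4 * K) with hκ
  have hκ0 : 0 < κ := by positivity
  have hκ1 : κ ≤ 1 / 4 := by
    rw [hκ]; apply one_div_le_one_div_of_le <;> linarith
  set γ : ℝ := min (1 / 2) (min (κ * α) κ) with hγ
  have g1 : γ ≤ 1 / 2 := min_le_left _ _
  have g2 : γ ≤ κ * α := (min_le_right _ _).trans (min_le_left _ _)
  have g3 : γ ≤ κ := (min_le_right _ _).trans (min_le_right _ _)
  have hγ0 : 0 < γ := lt_min (by norm_num) (lt_min (by positivity) hκ0)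
  refine ⟨γ, hγ0, C * C' + C + C * 2 ^ K * (2 * D), by positivity, fun t ht => ?_⟩
  have ht0 : 0 < t := by linarith
  set M : ℝ := 2 * κ * Real.log t with hM
  have hlog0 : 0 ≤ Real.log t := Real.log_nonneg ht
  have hlog : Real.log t ≤ t := (Real.log_le_sub_one_of_pos ht0).trans (by linarith)
  have hMt : M ≤ t / 2 := by
    rw [hM]; nlinarith
  have hs : t / 2 ≤ t - M := by linarith
  have heM : Real.exp M = t ^ (2 * κ) := by
    rw [Real.rpow_def_of_pos ht0, hM]; ring_nf
  have h := H M (t ^ (-κ)) (t - M) (Real.rpow_pos_of_pos ht0 _) (by linarith)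
  rw [sub_add_cancel] at h
  have hneg : 1 / t ^ γ = t ^ (-γ) := by rw [Real.rpow_neg ht0.le, one_div]
  have b1 : (t ^ (-κ)) ^ α ≤ t ^ (-γ) := by
    rw [← Real.rpow_mul ht0.le]
    exact Real.rpow_le_rpow_of_exponent_le ht (by linarith)
  have b2 : 1 / (1 + Real.exp M * t ^ (-κ)) ≤ t ^ (-γ) := by
    rw [heM, ← Real.rpow_add ht0, ← hneg]
    apply one_div_le_one_div_of_le (Real.rpow_pos_of_pos ht0 _)
    have : t ^ γ ≤ t ^ (2 * κ + -κ) := Real.rpow_le_rpow_of_exponent_le ht (by linarith)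
    linarith
  have b3 : (1 + Real.exp M) ^ K * (D / (t - M)) ≤ 2 ^ K * (2 * D) * t ^ (-γ) := by
    have c1 : 1 ≤ t ^ (2 * κ) := Real.one_le_rpow ht (by positivity)
    have c2 : (1 + Real.exp M) ^ K ≤ 2 ^ K * t ^ (1 / 2 : ℝ) := by
      calc (1 + Real.exp M) ^ K ≤ (2 * t ^ (2 * κ)) ^ K := by
            rw [heM]; gcongr; linarith
        _ = 2 ^ K * t ^ (1 / 2 : ℝ) := by
            rw [mul_pow, ← Real.rpow_natCast (t ^ (2 * κ)), ← Real.rpow_mul ht0.le]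
            congr 2
            rw [hκ]; field_simp; norm_num
    have c3 : D / (t - M) ≤ 2 * D * t ^ (-1 : ℝ) := by
      rw [Real.rpow_neg_one, div_le_iff₀ (by linarith)]
      have : 2 * D * t⁻¹ * (t / 2) ≤ 2 * D * t⁻¹ * (t - M) := by gcongr
      have e : 2 * D * t⁻¹ * (t / 2) = D := by field_simp
      linarith
    have c4 : t ^ (1 / 2 : ℝ) * t ^ (-1 : ℝ) ≤ t ^ (-γ) := by
      rw [← Real.rpow_add ht0]
      exact Real.rpow_le_rpow_of_exponent_le ht (by linarith)
    have c5 : 0 ≤ D / (t - M) := by apply div_nonneg <;> linarith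
    calc (1 + Real.exp M) ^ K * (D / (t - M)) ≤ (2 ^ K * t ^ (1 / 2 : ℝ)) * (2 * D * t ^ (-1 : ℝ)) := by gcongr
      _ = 2 ^ K * (2 * D) * (t ^ (1 / 2 : ℝ) * t ^ (-1 : ℝ)) := by ring
      _ ≤ _ := by gcongr
  rw [div_eq_mul_one_div, hneg]
  have d1 := mul_le_mul_of_nonneg_left b1 (mul_pos hC hC').le
  have d2 := mul_le_mul_of_nonneg_left b2 hC.le
  have d3 := mul_le_mul_of_nonneg_left b3 hC.le
  linarith

end fin
end S19

/-- quantitative main theorem: let `F ⊆ [0,1]` be a non-singleton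
self-similar set for `f_j(x) = r_j x + b_j`, and suppose `log r_i / log r_j` is
diophantine for some `i ≠ j` (there exist `c > 0`, `l > 2` with
`|log r_i/log r_j − a/q| ≥ c/q^l` for all integers `a` and positive integers `q`).
Then for every self-similar measure `μ` on `F` there is `β > 0` with
`|μ̂(ξ)| = O(1/|log|ξ||^β)` as `|ξ| → ∞`. -/
theorem stmt19 {A : Type*} [Fintype A] (r b p : A → ℝ)
    (hr : ∀ j, 0 < r j ∧ r j < 1) (hp : ∀ j, 0 < p j ∧ p j < 1)
    (hpsum : ∑ j, p j = 1)
    (F : Set ℝ) (hF1 : F ⊆ Set.Icc 0 1) (hFc : IsCompact F) (hFne : F.Nonempty)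
    (hFss : F = ⋃ j, (fun y => r j * y + b j) '' F)
    (hFns : ¬ ∃ y, F = {y})
    (hdio : ∃ i j, i ≠ j ∧ ∃ c > (0 : ℝ), ∃ l > (2 : ℝ), ∀ (a : ℤ) (q : ℕ), 0 < q →
      c / (q : ℝ) ^ l ≤ |Real.log (r i) / Real.log (r j) - (a : ℝ) / (q : ℝ)|)
    (μ : Measure ℝ) [IsProbabilityMeasure μ] (hμF : μ F = 1)
    (hss : μ = ∑ j, ENNReal.ofReal (p j) • Measure.map (fun y => r j * y + b j) μ) :
    ∃ β > (0 : ℝ), ∃ C > (0 : ℝ), ∃ ξ₀ : ℝ, ∀ ξ : ℝ, ξ₀ ≤ |ξ| →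
      ‖∫ y, Complex.exp (-2 * Real.pi * Complex.I * ξ * y) ∂μ‖ ≤
        C / (abs (Real.log (abs ξ))) ^ β := by
  have hp' : ∀ j, 0 < p j := fun j => (hp j).1
  obtain ⟨i, j, -, c, hc, l, -, hd⟩ := hdio
  have : Nonempty A := ⟨i⟩
  let X : A → ℝ := fun k => -Real.log (r k)
  have hXpos : ∀ k, 0 < X k := fun k => neg_pos.2 (Real.log_neg (hr k).1 (hr k).2)
  obtain ⟨km, hkm⟩ := Finite.exists_min X
  obtain ⟨kM, hkM⟩ := Finite.exists_max X
  have hd' : ∀ (a : ℤ) (q : ℕ), 0 < q → c / (q : ℝ) ^ l ≤ |X i / X j - (a : ℝ) / (q : ℝ)| := by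
    intro a q hq
    simpa only [X, neg_div_neg_eq] using hd a q hq
  have hD0 := hXpos kM
  set θ0 : ℝ := min 1 (1 / (4 * X kM)) with hθ
  have hθ0 : 0 < θ0 := lt_min one_pos (by positivity)
  obtain ⟨K, c2, hc2, h2⟩ := S19.phi_large (p := p) (X := X) hp' hpsum hXpos θ0 hθ0 i j c l hc hd'
  obtain ⟨χ, hχ, hχ0, hχ1, hI⟩ := S19.exists_bump (X kM) hD0
  obtain ⟨C, hC, hest⟩ := S19.main_est (p := p) (X := X) hp' hpsum (X km) (hXpos km) hkm θ0 (4 * X km) c2 hθ0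
    (min_le_left _ _) (by have := hXpos km; positivity) hc2 K
    (fun θ h => S19.phi_small hp' hpsum (X km) (X kM) (hXpos km) hkm hkM hD0 θ (h.trans (min_le_right _ _)))
    h2 _ hχ hI
  obtain ⟨α, hα, C', hC', hfr⟩ := S19.frostman hr hp' hpsum F hF1 hFc hFne hFss hFns hμF hss
  obtain ⟨γ, hγ, C'', hC'', hg⟩ := S19.choice (2 * K + 2) (by omega) α C C' (X kM) hα hC hC' hD0
    (fun t => ‖S19.mh μ (Real.exp t)‖ ^ 2)
    (fun M δ s hδ hs => S19.core (fun k => (hr k).1) hp' hpsum hss F hF1 hFc hμF X rfl (X km) (X kM)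
      (hXpos km) hD0 hkm hkM χ hχ0 hχ1 C hC (2 * K + 2) hest α C' hfr M δ s hδ hs)
  refine ⟨γ / 2, by positivity, Real.sqrt C'', Real.sqrt_pos.2 hC'', Real.exp 1, fun ξ hξ => ?_⟩
  change ‖S19.mh μ ξ‖ ≤ _
  have hξ0 : 0 < |ξ| := (Real.exp_pos 1).trans_le hξ
  have hlog : 1 ≤ Real.log |ξ| := by rwa [Real.le_log_iff_exp_le hξ0]
  have h := hg _ hlog
  simp only [Real.exp_log hξ0, S19.mh_abs] at h
  rw [abs_of_pos (by linarith : 0 < Real.log |ξ|)]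
  apply le_of_sq_le_sq _ (by positivity)
  have hsq : (Real.log |ξ| ^ (γ / 2)) ^ 2 = Real.log |ξ| ^ γ := by
    rw [pow_two, ← Real.rpow_add (by linarith), add_halves]
  rw [div_pow, Real.sq_sqrt hC''.le, hsq]
  exact h
end
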